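/- arXiv:1609.05573 — 9 statements merged into one kernel-verified Lean document; each statement's English description precedes it below -/
import Mathlib

section
/- Let (P_n), (P̃_n), (Q_n) be sequences of probability measures on measurable spaces (Ω_n, F_n). Suppose there are measurable events ω_n with P_n(ω_n) → 1 such that P_n and P̃_n agree within ω_n, i.e. P_n(A ∩ ω_n) = P̃_n(A ∩ ω_n) for every measurable A. If each P̃_n is absolutely continuous with respect to Q_n and ∫ (dP̃_n/dQ_n)² dQ_n remains bounded as n → ∞, then P_n is contiguous to Q_n. -/
open MeasureTheory Filter Topology
open scoped ENNReal

/-- A sequence of probability measures `P n` is contiguous to `Q n` if for every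
sequence of measurable events `A n`, `Q n (A n) → 0` implies `P n (A n) → 0`. -/
def Contiguous {Ω : ℕ → Type*} [∀ n, MeasurableSpace (Ω n)]
    (P Q : (n : ℕ) → Measure (Ω n)) : Prop :=
  ∀ A : (n : ℕ) → Set (Ω n), (∀ n, MeasurableSet (A n)) →
    Tendsto (fun n => Q n (A n)) atTop (𝓝 0) →
    Tendsto (fun n => P n (A n)) atTop (𝓝 0)

/-- Cauchy–Schwarz bound for a measure in terms of the second moment of its density. -/
theorem measure_le_sqrt_lintegral_rnDeriv_sq_mul {α : Type*} [MeasurableSpace α]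
    (μ ν : Measure α) [SigmaFinite μ] [SigmaFinite ν] (h : μ ≪ ν) (s : Set α) :
    μ s ≤ (∫⁻ x, (μ.rnDeriv ν x) ^ 2 ∂ν) ^ (1 / 2 : ℝ) * ν s ^ (1 / 2 : ℝ) := by
  have holder := ENNReal.lintegral_mul_le_Lp_mul_Lq (ν.restrict s) Real.HolderConjugate.two_two
    (Measure.measurable_rnDeriv μ ν).aemeasurable (aemeasurable_const (b := (1 : ℝ≥0∞)))
  simp only [Pi.mul_apply, mul_one, one_pow, lintegral_one,
    Measure.restrict_apply_univ, ENNReal.rpow_two] at holder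
  rw [Measure.setLIntegral_rnDeriv h] at holder
  refine holder.trans ?_
  gcongr
  exact Measure.restrict_le_self

/-- Conditioning method: if `P n (ω n) → 1`, `P n` and `P̃ n` agree within `ω n`,
`P̃ n ≪ Q n`, and the second moments `∫ (dP̃_n/dQ_n)² dQ_n` are bounded, then
`P` is contiguous to `Q`. -/
theorem stmt_2 {Ω : ℕ → Type*} [∀ n, MeasurableSpace (Ω n)]
    (P Pt Q : (n : ℕ) → Measure (Ω n))
    [∀ n, IsProbabilityMeasure (P n)] [∀ n, IsProbabilityMeasure (Pt n)]
    [∀ n, IsProbabilityMeasure (Q n)]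
    (ω : (n : ℕ) → Set (Ω n)) (hω : ∀ n, MeasurableSet (ω n))
    (hgood : Tendsto (fun n => P n (ω n)) atTop (𝓝 1))
    (hagree : ∀ n, ∀ A : Set (Ω n), MeasurableSet A → P n (A ∩ ω n) = Pt n (A ∩ ω n))
    (hac : ∀ n, Pt n ≪ Q n)
    (C : ℝ≥0∞) (hC : C ≠ ⊤)
    (hbd : ∀ n, ∫⁻ x, ((Pt n).rnDeriv (Q n) x) ^ 2 ∂(Q n) ≤ C) :
    Contiguous P Q := by
  intro A hA hQA
  have bound : ∀ n, P n (A n) ≤ C ^ (1 / 2 : ℝ) * Q n (A n) ^ (1 / 2 : ℝ) + (1 - P n (ω n)) := by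
    intro n
    rw [← measure_inter_add_sdiff (A n) (hω n), hagree n _ (hA n)]
    refine add_le_add ?_ ?_
    · refine (measure_mono Set.inter_subset_left).trans
        ((measure_le_sqrt_lintegral_rnDeriv_sq_mul (Pt n) (Q n) (hac n) (A n)).trans ?_)
      gcongr
      exact hbd n
    · rw [← prob_compl_eq_one_sub (hω n)]
      exact measure_mono fun x hx => hx.2
  refine tendsto_of_tendsto_of_tendsto_of_le_of_le tendsto_const_nhds ?_
    (fun _ => zero_le) bound
  have main : Tendsto (fun n => C ^ (1 / 2 : ℝ) * Q n (A n) ^ (1 / 2 : ℝ)) atTop (𝓝 0) := by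
    have sqrt_tendsto := hQA.ennrpow_const (1 / 2 : ℝ)
    rw [ENNReal.zero_rpow_of_pos (by norm_num)] at sqrt_tendsto
    simpa using ENNReal.Tendsto.const_mul sqrt_tendsto
      (Or.inr (ENNReal.rpow_ne_top_of_nonneg (by norm_num) hC))
  have compl_tendsto : Tendsto (fun n => 1 - P n (ω n)) atTop (𝓝 0) := by
    simpa using ENNReal.Tendsto.sub tendsto_const_nhds hgood (Or.inl ENNReal.one_ne_top)
  simpa using main.add compl_tendsto
end

section
/- Let P and Q be probability measures on a common measurable space with P absolutely continuous with respect to Q, and let A be a measurable event with 0 < Q(A) < 1. Set α = Q(A) (the type I error of the test that reports 'P' on A) and β = 1 − P(A) (the type II error). Then (1−β)²/α + β²/(1−α) ≤ ∫ (dP/dQ)² dQ, assuming the right-hand side is finite. -/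
open MeasureTheory
open scoped ENNReal

/-- Cauchy-Schwarz inequality against the constant function `1`. -/
theorem sq_lintegral_le_measure_univ_mul_lintegral_sq {Ω : Type*} [MeasurableSpace Ω]
    (μ : Measure Ω) {f : Ω → ℝ≥0∞} (hf : AEMeasurable f μ) :
    (∫⁻ ω, f ω ∂μ) ^ 2 ≤ μ Set.univ * ∫⁻ ω, f ω ^ 2 ∂μ := by
  have h := ENNReal.lintegral_mul_le_Lp_mul_Lq μ Real.HolderConjugate.two_two
    (aemeasurable_const (b := (1 : ℝ≥0∞))) hf
  have hsqrt (x : ℝ≥0∞) : (x ^ (1 / 2 : ℝ)) ^ 2 = x := by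
    rw [← ENNReal.rpow_natCast, ← ENNReal.rpow_mul]
    norm_num
  have h2 := pow_le_pow_left' h 2
  rw [mul_pow, hsqrt, hsqrt] at h2
  simpa using h2

/-- The ratio `P(S)² / Q(S)` is bounded by the second moment of the likelihood ratio on `S`. -/
theorem sq_measure_div_le_setLIntegral_rnDeriv_sq {Ω : Type*} [MeasurableSpace Ω]
    (P Q : Measure Ω) [IsFiniteMeasure P] [IsFiniteMeasure Q] (hac : P ≪ Q) {S : Set Ω}
    (hS : 0 < (Q S).toReal) (hfin : ∫⁻ ω in S, (P.rnDeriv Q ω) ^ 2 ∂Q ≠ ⊤) :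
    (P S).toReal ^ 2 / (Q S).toReal ≤ (∫⁻ ω in S, (P.rnDeriv Q ω) ^ 2 ∂Q).toReal := by
  have h := sq_lintegral_le_measure_univ_mul_lintegral_sq (Q.restrict S)
    (P.measurable_rnDeriv Q).aemeasurable
  rw [Measure.setLIntegral_rnDeriv hac, Measure.restrict_apply_univ] at h
  have h2 := ENNReal.toReal_mono (ENNReal.mul_ne_top (measure_ne_top Q S) hfin) h
  rw [ENNReal.toReal_pow, ENNReal.toReal_mul] at h2
  rwa [div_le_iff₀' hS]

/-- Hypothesis testing bound: for probability measures `P ≪ Q` and a measurable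
event `A` with `0 < Q A < 1`, setting `α = Q A` (type I error) and `β = 1 - P A`
(type II error), we have `(1-β)²/α + β²/(1-α) ≤ ∫ (dP/dQ)² dQ`, assuming the
right-hand side is finite. -/
theorem stmt_3 {Ω : Type*} [MeasurableSpace Ω] (P Q : Measure Ω)
    [IsProbabilityMeasure P] [IsProbabilityMeasure Q] (hac : P ≪ Q)
    (A : Set Ω) (hA : MeasurableSet A) (h0 : 0 < Q A) (h1 : Q A < 1)
    (hfin : ∫⁻ ω, (P.rnDeriv Q ω) ^ 2 ∂Q ≠ ⊤)
    (α β : ℝ) (hα : α = (Q A).toReal) (hβ : β = 1 - (P A).toReal) :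
    (1 - β) ^ 2 / α + β ^ 2 / (1 - α) ≤ (∫⁻ ω, (P.rnDeriv Q ω) ^ 2 ∂Q).toReal := by
  have hsplit := lintegral_add_compl (μ := Q) (fun ω => (P.rnDeriv Q ω) ^ 2) hA
  have hfinA (S : Set Ω) : ∫⁻ ω in S, (P.rnDeriv Q ω) ^ 2 ∂Q ≠ ⊤ :=
    ne_top_of_le_ne_top hfin (setLIntegral_le_lintegral S _)
  have hPc : (P Aᶜ).toReal = β := by
    rw [hβ]
    exact probReal_compl_eq_one_sub hA
  have hQc : (Q Aᶜ).toReal = 1 - α := by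
    rw [hα]
    exact probReal_compl_eq_one_sub hA
  have hα_pos : 0 < α := hα ▸ ENNReal.toReal_pos h0.ne' (measure_ne_top Q A)
  have hα_lt : α < 1 := by
    rw [hα]
    simpa using (ENNReal.toReal_lt_toReal (measure_ne_top Q A) ENNReal.one_ne_top).2 h1
  have hA_le := sq_measure_div_le_setLIntegral_rnDeriv_sq P Q hac (hα ▸ hα_pos) (hfinA A)
  have hAc_le := sq_measure_div_le_setLIntegral_rnDeriv_sq P Q hac
    (hQc ▸ sub_pos.2 hα_lt) (hfinA Aᶜ)
  rw [hPc, hQc] at hAc_le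
  rw [← hα, show (P A).toReal = 1 - β by rw [hβ]; ring] at hA_le
  rw [← hsplit, ENNReal.toReal_add (hfinA A) (hfinA Aᶜ)]
  exact add_le_add hA_le hAc_le
end

section
/- Fix n ≥ 1, λ ≥ 0, and a probability measure 𝒳_n on ℝⁿ. Let Q_n = GWig_n(0) be the unspiked Gaussian Wigner measure and let P_n = GWig_n(λ, 𝒳) be the spiked measure. Then P_n is absolutely continuous with respect to Q_n and, as an identity in [0,∞], ∫ (dP_n/dQ_n)² dQ_n = ∫∫ exp((λ² n / 2) · ⟨x, x'⟩²) d𝒳_n(x) d𝒳_n(x'), where x, x' are two independent draws from 𝒳_n and ⟨·,·⟩ is the Euclidean inner product on ℝⁿ. -/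
open MeasureTheory Filter Topology ProbabilityTheory
open scoped ENNReal NNReal

/-- The unspiked Gaussian Wigner measure `GWig_n(0)`: the law of the random symmetric
`n × n` real matrix `Y` with `Y i j = W (i,j) + W (j,i)` where the `W p` are i.i.d.
`N(0, 1/(2n))`; thus `Y i j ~ N(0, 1/n)` off the diagonal, `Y i i ~ N(0, 2/n)`, and the
entries are independent up to the symmetry `Y i j = Y j i`. -/
noncomputable def gwigUnspiked (n : ℕ) : Measure (Fin n → Fin n → ℝ) :=
  (Measure.pi fun _ : Fin n × Fin n => gaussianReal 0 (1 / (2 * (n : ℝ≥0)))).map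
    fun W i j => W (i, j) + W (j, i)

/-- The spiked Gaussian Wigner measure `GWig_n(λ, 𝒳)`: mixture over `x ~ 𝒳` of the
pushforward of `GWig_n(0)` under `Y ↦ λ x xᵀ + Y`. -/
noncomputable def gwigSpiked (n : ℕ) (lam : ℝ) (prior : Measure (Fin n → ℝ)) :
    Measure (Fin n → Fin n → ℝ) :=
  prior.bind fun x => (gwigUnspiked n).map fun Y i j => lam * (x i * x j) + Y i j

section Mixture

variable {α β : Type*} [MeasurableSpace α] [MeasurableSpace β]

theorem bind_withDensity_eq_withDensity_lintegral (μ : Measure α) [SFinite μ] (ν : Measure β)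
    [SFinite ν] {L : α → β → ℝ≥0∞} (hL : Measurable (Function.uncurry L)) :
    μ.bind (fun x => ν.withDensity (L x)) = ν.withDensity fun y => ∫⁻ x, L x y ∂μ := by
  have hmeas : Measurable fun x => ν.withDensity (L x) := by
    refine Measure.measurable_of_measurable_coe _ fun s hs => ?_
    simp_rw [withDensity_apply _ hs]
    exact hL.lintegral_prod_right'
  ext s hs
  rw [Measure.bind_apply hs hmeas.aemeasurable, withDensity_apply _ hs]
  simp_rw [withDensity_apply _ hs]
  exact lintegral_lintegral_swap hL.aemeasurable

theorem lintegral_sq_lintegral_eq (μ : Measure α) [SFinite μ] (ν : Measure β) [SFinite ν]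
    {L : α → β → ℝ≥0∞} (hL : Measurable (Function.uncurry L)) :
    ∫⁻ y, (∫⁻ x, L x y ∂μ) ^ 2 ∂ν = ∫⁻ x, ∫⁻ x', ∫⁻ y, L x y * L x' y ∂ν ∂μ ∂μ := by
  have hx (x : α) : Measurable (L x) := hL.comp measurable_prodMk_left
  have hy (y : β) : Measurable fun x => L x y := hL.comp measurable_prodMk_right
  have hint : Measurable fun y => ∫⁻ x, L x y ∂μ := hL.lintegral_prod_left'
  calc ∫⁻ y, (∫⁻ x, L x y ∂μ) ^ 2 ∂ν
      = ∫⁻ y, ∫⁻ x, L x y * ∫⁻ x', L x' y ∂μ ∂μ ∂ν := by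
        refine lintegral_congr fun y => ?_
        rw [lintegral_mul_const _ (hy y), sq]
    _ = ∫⁻ x, ∫⁻ y, L x y * ∫⁻ x', L x' y ∂μ ∂ν ∂μ := by
        refine lintegral_lintegral_swap (f := fun y x => L x y * ∫⁻ x', L x' y ∂μ) ?_
        exact ((hL.comp measurable_swap).mul (hint.comp measurable_fst)).aemeasurable
    _ = ∫⁻ x, ∫⁻ x', ∫⁻ y, L x y * L x' y ∂ν ∂μ ∂μ := by
        refine lintegral_congr fun x => ?_
        simp_rw [← lintegral_const_mul _ (hy _)]
        refine lintegral_lintegral_swap (f := fun y x' => L x y * L x' y) ?_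
        exact (((hx x).comp measurable_fst).mul (hL.comp measurable_swap)).aemeasurable

end Mixture

section ProductDensity

variable {ι : Type*} [Fintype ι] {Ω : ι → Type*} [∀ i, MeasurableSpace (Ω i)]

theorem lintegral_pi_prod_eq_prod_lintegral (μ : ∀ i, Measure (Ω i))
    [∀ i, IsProbabilityMeasure (μ i)] {f : ∀ i, Ω i → ℝ≥0∞} (hf : ∀ i, Measurable (f i)) :
    ∫⁻ w, ∏ i, f i (w i) ∂Measure.pi μ = ∏ i, ∫⁻ x, f i x ∂μ i := by
  rw [lintegral_prod_eq_prod_lintegral_of_indepFun _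
    (fun i (w : ∀ i, Ω i) => f i (w i)) (iIndepFun_pi fun i => (hf i).aemeasurable)
    fun i => (hf i).comp (measurable_pi_apply i)]
  refine Finset.prod_congr rfl fun i _ => ?_
  exact (measurePreserving_eval μ i).lintegral_comp (hf i)

theorem pi_withDensity_eq_withDensity_prod (μ : ∀ i, Measure (Ω i))
    [∀ i, IsProbabilityMeasure (μ i)] {f : ∀ i, Ω i → ℝ≥0∞} (hf : ∀ i, Measurable (f i))
    [∀ i, SigmaFinite ((μ i).withDensity (f i))] :
    Measure.pi (fun i => (μ i).withDensity (f i)) =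
      (Measure.pi μ).withDensity fun w => ∏ i, f i (w i) := by
  refine Measure.pi_eq fun s hs => ?_
  have hbox : MeasurableSet (Set.univ.pi s) := MeasurableSet.univ_pi hs
  have hind (w : ∀ i, Ω i) : (Set.univ.pi s).indicator (fun w => ∏ i, f i (w i)) w =
      ∏ i, (s i).indicator (f i) (w i) := by
    by_cases hw : w ∈ Set.univ.pi s
    · rw [Set.indicator_of_mem hw]
      exact Finset.prod_congr rfl fun i _ => (Set.indicator_of_mem (hw i trivial) _).symm
    · rw [Set.indicator_of_notMem hw]
      obtain ⟨i, hi⟩ : ∃ i, w i ∉ s i := by simpa [Set.mem_pi] using hw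
      exact (Finset.prod_eq_zero (Finset.mem_univ i) (Set.indicator_of_notMem hi _)).symm
  rw [withDensity_apply _ hbox, ← lintegral_indicator hbox]
  simp_rw [hind]
  rw [lintegral_pi_prod_eq_prod_lintegral μ fun i => (hf i).indicator (hs i)]
  refine Finset.prod_congr rfl fun i _ => ?_
  rw [lintegral_indicator (hs i), withDensity_apply _ (hs i)]

end ProductDensity

section GaussianShift

theorem gaussianReal_eq_withDensity_exp (m : ℝ) {v : ℝ≥0} (hv : v ≠ 0) :
    gaussianReal m v = (gaussianReal 0 v).withDensity fun w =>
      ENNReal.ofReal (Real.exp (m * w / v - m ^ 2 / (2 * v))) := by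
  have hv' : (v : ℝ) ≠ 0 := by exact_mod_cast hv
  rw [gaussianReal_of_var_ne_zero m hv, gaussianReal_of_var_ne_zero 0 hv,
    ← withDensity_mul _ (measurable_gaussianPDF 0 v) (by fun_prop)]
  congr 1
  ext w
  rw [Pi.mul_apply, gaussianPDF, gaussianPDF, ← ENNReal.ofReal_mul (gaussianPDFReal_nonneg _ _ _),
    gaussianPDFReal, gaussianPDFReal, mul_assoc (√_)⁻¹, ← Real.exp_add]
  congr 3
  field_simp
  ring

theorem lintegral_exp_mul_gaussianReal (t : ℝ) (v : ℝ≥0) :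
    ∫⁻ w, ENNReal.ofReal (Real.exp (t * w)) ∂gaussianReal 0 v =
      ENNReal.ofReal (Real.exp (v * t ^ 2 / 2)) := by
  rw [← ofReal_integral_eq_lintegral_ofReal (integrable_exp_mul_gaussianReal t)
    (ae_of_all _ fun _ => (Real.exp_pos _).le)]
  have h := congrFun (mgf_fun_id_gaussianReal (μ := 0) (v := v)) t
  rw [mgf] at h
  rw [h, zero_mul, zero_add]

variable {ι : Type*} [Fintype ι]

theorem ofReal_exp_sum (f : ι → ℝ) :
    ENNReal.ofReal (Real.exp (∑ i, f i)) = ∏ i, ENNReal.ofReal (Real.exp (f i)) := by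
  rw [Real.exp_sum, ENNReal.ofReal_prod_of_nonneg fun i _ => (Real.exp_pos _).le]

theorem pi_gaussianReal_map_const_add (m : ι → ℝ) {v : ℝ≥0} (hv : v ≠ 0) :
    (Measure.pi fun _ : ι => gaussianReal 0 v).map (fun w i => m i + w i) =
      (Measure.pi fun _ : ι => gaussianReal 0 v).withDensity fun w =>
        ENNReal.ofReal (Real.exp (∑ i, (m i * w i / v - m i ^ 2 / (2 * v)))) := by
  have hshift (i : ι) : (gaussianReal 0 v).map (fun w => m i + w) =
      (gaussianReal 0 v).withDensity fun w =>
        ENNReal.ofReal (Real.exp (m i * w / v - m i ^ 2 / (2 * v))) := by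
    rw [gaussianReal_map_const_add, zero_add, gaussianReal_eq_withDensity_exp _ hv]
  have hfin (i : ι) : SigmaFinite ((gaussianReal 0 v).map fun w => m i + w) := by
    rw [gaussianReal_map_const_add]; infer_instance
  have hfin' (i : ι) : SigmaFinite ((gaussianReal 0 v).withDensity fun w =>
      ENNReal.ofReal (Real.exp (m i * w / v - m i ^ 2 / (2 * v)))) := hshift i ▸ hfin i
  rw [Measure.pi_map_pi fun i => (measurable_const_add (m i)).aemeasurable]
  simp_rw [hshift, ofReal_exp_sum]
  exact pi_withDensity_eq_withDensity_prod _ fun i => by fun_prop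

theorem lintegral_exp_sum_pi_gaussianReal (t : ι → ℝ) (v : ℝ≥0) :
    ∫⁻ w, ENNReal.ofReal (Real.exp (∑ i, t i * w i)) ∂(Measure.pi fun _ : ι => gaussianReal 0 v) =
      ENNReal.ofReal (Real.exp (∑ i, v * t i ^ 2 / 2)) := by
  simp_rw [ofReal_exp_sum]
  rw [lintegral_pi_prod_eq_prod_lintegral (fun _ : ι => gaussianReal 0 v)
    (f := fun i x => ENNReal.ofReal (Real.exp (t i * x))) fun i => by fun_prop]
  simp_rw [lintegral_exp_mul_gaussianReal]

end GaussianShift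

section Wigner

variable {n : ℕ}

/-- The likelihood ratio of `lam • x xᵀ + Y` against `Y ~ GWig_n(0)`. -/
noncomputable def gwigLikelihood (n : ℕ) (lam : ℝ) (x : Fin n → ℝ) (Y : Fin n → Fin n → ℝ) :
    ℝ≥0∞ :=
  ENNReal.ofReal (Real.exp (n * lam / 2 * ∑ i, ∑ j, x i * x j * Y i j -
    n * lam ^ 2 / 4 * (∑ i, x i ^ 2) ^ 2))

theorem measurable_gwigLikelihood (lam : ℝ) :
    Measurable (Function.uncurry (gwigLikelihood n lam)) := by
  unfold gwigLikelihood Function.uncurry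
  fun_prop

theorem measurable_gwigLikelihood_right (lam : ℝ) (x : Fin n → ℝ) :
    Measurable (gwigLikelihood n lam x) :=
  (measurable_gwigLikelihood lam).of_uncurry_left

theorem measurable_symmetrize :
    Measurable fun (W : Fin n × Fin n → ℝ) (i j : Fin n) => W (i, j) + W (j, i) := by
  fun_prop

theorem sum_mul_symmetrize (x : Fin n → ℝ) (W : Fin n × Fin n → ℝ) :
    ∑ i, ∑ j, x i * x j * (W (i, j) + W (j, i)) = 2 * ∑ p : Fin n × Fin n, x p.1 * x p.2 * W p := by
  simp_rw [Fintype.sum_prod_type, mul_add, Finset.sum_add_distrib]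
  rw [Finset.sum_comm (f := fun i j => x i * x j * W (j, i)), two_mul]
  simp_rw [mul_comm (x _) (x _)]

theorem sum_prod_mul_mul (x y : Fin n → ℝ) :
    ∑ p : Fin n × Fin n, x p.1 * x p.2 * (y p.1 * y p.2) = (∑ i, x i * y i) ^ 2 := by
  rw [Fintype.sum_prod_type, sq, Finset.sum_mul_sum]
  exact Finset.sum_congr rfl fun i _ => Finset.sum_congr rfl fun j _ => by ring

instance isProbabilityMeasure_gwigUnspiked : IsProbabilityMeasure (gwigUnspiked n) :=
  Measure.isProbabilityMeasure_map measurable_symmetrize.aemeasurable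

theorem gwigUnspiked_map_spike (hn : n ≠ 0) (lam : ℝ) (x : Fin n → ℝ) :
    (gwigUnspiked n).map (fun Y i j => lam * (x i * x j) + Y i j) =
      (gwigUnspiked n).withDensity (gwigLikelihood n lam x) := by
  have hv : (1 / (2 * (n : ℝ≥0))) ≠ 0 := by simp [hn]
  have hn' : (n : ℝ) ≠ 0 := by exact_mod_cast hn
  have hcomp : (gwigUnspiked n).map (fun Y i j => lam * (x i * x j) + Y i j) =
      ((Measure.pi fun _ : Fin n × Fin n => gaussianReal 0 (1 / (2 * (n : ℝ≥0)))).map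
        fun W p => lam / 2 * (x p.1 * x p.2) + W p).map
          fun W i j => W (i, j) + W (j, i) := by
    rw [gwigUnspiked, Measure.map_map (by fun_prop) measurable_symmetrize,
      Measure.map_map measurable_symmetrize (by fun_prop)]
    congr 1
    ext W i j
    simp only [Function.comp_apply]
    ring
  rw [hcomp, pi_gaussianReal_map_const_add _ hv]
  ext s hs
  rw [Measure.map_apply measurable_symmetrize hs,
    withDensity_apply _ (measurable_symmetrize hs), withDensity_apply _ hs, gwigUnspiked,
    setLIntegral_map hs (measurable_gwigLikelihood_right lam x) measurable_symmetrize]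
  refine lintegral_congr fun W => ?_
  rw [gwigLikelihood, sum_mul_symmetrize]
  congr 2
  have hsq := sum_prod_mul_mul x x
  simp_rw [← sq] at hsq
  rw [← hsq, Finset.sum_sub_distrib, Finset.mul_sum, Finset.mul_sum, Finset.mul_sum]
  congr 1 <;> refine Finset.sum_congr rfl fun p _ => ?_ <;> push_cast <;> field_simp <;> ring

theorem lintegral_gwigLikelihood_mul (hn : n ≠ 0) (lam : ℝ) (x x' : Fin n → ℝ) :
    ∫⁻ Y, gwigLikelihood n lam x Y * gwigLikelihood n lam x' Y ∂gwigUnspiked n =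
      ENNReal.ofReal (Real.exp (lam ^ 2 * n / 2 * (∑ i, x i * x' i) ^ 2)) := by
  have hn' : (n : ℝ) ≠ 0 := by exact_mod_cast hn
  rw [gwigUnspiked, lintegral_map
    (f := fun Y => gwigLikelihood n lam x Y * gwigLikelihood n lam x' Y)
    ((measurable_gwigLikelihood_right lam x).mul (measurable_gwigLikelihood_right lam x')) measurable_symmetrize]
  have hsplit (W : Fin n × Fin n → ℝ) :
      gwigLikelihood n lam x (fun i j => W (i, j) + W (j, i)) *
        gwigLikelihood n lam x' (fun i j => W (i, j) + W (j, i)) =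
      ENNReal.ofReal (Real.exp (-(n * lam ^ 2 / 4 * ((∑ i, x i ^ 2) ^ 2 + (∑ i, x' i ^ 2) ^ 2)))) *
        ENNReal.ofReal (Real.exp
          (∑ p : Fin n × Fin n, n * lam * (x p.1 * x p.2 + x' p.1 * x' p.2) * W p)) := by
    have hlin : ∑ p : Fin n × Fin n, n * lam * (x p.1 * x p.2 + x' p.1 * x' p.2) * W p =
        n * lam * (∑ p : Fin n × Fin n, x p.1 * x p.2 * W p +
          ∑ p : Fin n × Fin n, x' p.1 * x' p.2 * W p) := by
      rw [← Finset.sum_add_distrib, Finset.mul_sum]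
      exact Finset.sum_congr rfl fun p _ => by ring
    simp_rw [gwigLikelihood, sum_mul_symmetrize, hlin,
      ← ENNReal.ofReal_mul (Real.exp_pos _).le, ← Real.exp_add]
    congr 2
    ring
  simp_rw [hsplit]
  rw [lintegral_const_mul _ (by fun_prop), lintegral_exp_sum_pi_gaussianReal,
    ← ENNReal.ofReal_mul (Real.exp_pos _).le, ← Real.exp_add]
  congr 2
  have hquad : ∑ p : Fin n × Fin n, ((1 / (2 * (n : ℝ≥0)) : ℝ≥0) : ℝ) *
      (n * lam * (x p.1 * x p.2 + x' p.1 * x' p.2)) ^ 2 / 2 =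
      n * lam ^ 2 / 4 * (∑ p : Fin n × Fin n, x p.1 * x p.2 * (x p.1 * x p.2) +
        2 * ∑ p : Fin n × Fin n, x p.1 * x p.2 * (x' p.1 * x' p.2) +
        ∑ p : Fin n × Fin n, x' p.1 * x' p.2 * (x' p.1 * x' p.2)) := by
    rw [Finset.mul_sum, ← Finset.sum_add_distrib, ← Finset.sum_add_distrib, Finset.mul_sum]
    refine Finset.sum_congr rfl fun p _ => ?_
    push_cast
    field_simp
    ring
  rw [hquad, sum_prod_mul_mul, sum_prod_mul_mul, sum_prod_mul_mul]
  simp_rw [← sq]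
  ring

end Wigner

/-- Second moment of the likelihood ratio for the spiked Gaussian Wigner model:
`P_n = GWig_n(λ, 𝒳)` is absolutely continuous w.r.t. `Q_n = GWig_n(0)` and
`∫ (dP_n/dQ_n)² dQ_n = E_{x,x' ~ 𝒳} exp((λ² n / 2) ⟨x,x'⟩²)` as an identity in `[0,∞]`. -/
theorem stmt_4 (n : ℕ) (hn : 1 ≤ n) (lam : ℝ) (hlam : 0 ≤ lam)
    (prior : Measure (Fin n → ℝ)) [IsProbabilityMeasure prior] :
    gwigSpiked n lam prior ≪ gwigUnspiked n ∧
      ∫⁻ Y, ((gwigSpiked n lam prior).rnDeriv (gwigUnspiked n) Y) ^ 2 ∂(gwigUnspiked n) =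
        ∫⁻ x, ∫⁻ x',
          ENNReal.ofReal (Real.exp (lam ^ 2 * n / 2 * (∑ i, x i * x' i) ^ 2))
          ∂prior ∂prior := by
  have hn' : n ≠ 0 := Nat.one_le_iff_ne_zero.mp hn
  have hL := measurable_gwigLikelihood (n := n) lam
  have hP : gwigSpiked n lam prior =
      (gwigUnspiked n).withDensity fun Y => ∫⁻ x, gwigLikelihood n lam x Y ∂prior := by
    rw [gwigSpiked, ← bind_withDensity_eq_withDensity_lintegral prior (gwigUnspiked n) hL]
    simp_rw [gwigUnspiked_map_spike hn']
  rw [hP]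
  refine ⟨withDensity_absolutelyContinuous _ _, ?_⟩
  calc ∫⁻ Y, (((gwigUnspiked n).withDensity fun Y => ∫⁻ x, gwigLikelihood n lam x Y ∂prior).rnDeriv
          (gwigUnspiked n) Y) ^ 2 ∂(gwigUnspiked n)
      = ∫⁻ Y, (∫⁻ x, gwigLikelihood n lam x Y ∂prior) ^ 2 ∂(gwigUnspiked n) := by
        refine lintegral_congr_ae ?_
        have hint : Measurable fun Y => ∫⁻ x, gwigLikelihood n lam x Y ∂prior :=
          hL.lintegral_prod_left'
        filter_upwards [Measure.rnDeriv_withDensity (gwigUnspiked n) hint] with Y hY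
        rw [hY]
    _ = _ := by
        rw [lintegral_sq_lintegral_eq prior (gwigUnspiked n) hL]
        simp_rw [lintegral_gwigLikelihood_mul hn']
end

section
/- Let 𝒳_n be the i.i.d. Rademacher spike prior: the law of x ∈ ℝⁿ whose coordinates are independent and uniform on {−1/√n, +1/√n}. For every λ with 0 ≤ λ < 1, the spiked Gaussian Wigner sequence GWig_n(λ, 𝒳) is contiguous to the unspiked sequence GWig_n(0). -/
open MeasureTheory Filter Topology ProbabilityTheory
open scoped ENNReal NNReal

/-- The i.i.d. Rademacher spike prior: the coordinates of `x ∈ ℝⁿ` are independent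
and uniform on `{-1/√n, +1/√n}`. -/
noncomputable def radPrior (n : ℕ) : Measure (Fin n → ℝ) :=
  Measure.pi fun _ : Fin n =>
    ((PMF.uniformOfFintype Bool).map
      fun b => if b then (Real.sqrt n)⁻¹ else -(Real.sqrt n)⁻¹).toMeasure

/-- The exponential, as an extended nonnegative real. -/
noncomputable def eexp (t : ℝ) : ℝ≥0∞ := ENNReal.ofReal (Real.exp t)

@[fun_prop]
lemma measurable_eexp : Measurable eexp := by
  unfold eexp
  fun_prop

lemma eexp_add (s t : ℝ) : eexp (s + t) = eexp s * eexp t := by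
  rw [eexp, Real.exp_add, ENNReal.ofReal_mul (Real.exp_pos _).le, eexp, eexp]

lemma eexp_sum {ι : Type*} (s : Finset ι) (f : ι → ℝ) :
    eexp (∑ i ∈ s, f i) = ∏ i ∈ s, eexp (f i) := by
  rw [eexp, Real.exp_sum, ENNReal.ofReal_prod_of_nonneg fun _ _ => (Real.exp_pos _).le]
  rfl

lemma eexp_mono {s t : ℝ} (h : s ≤ t) : eexp s ≤ eexp t :=
  ENNReal.ofReal_le_ofReal (Real.exp_le_exp.2 h)

lemma lintegral_pi_prod {ι : Type*} [Fintype ι] {X : ι → Type*} [∀ i, MeasurableSpace (X i)]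
    (μ : (i : ι) → Measure (X i)) [∀ i, IsProbabilityMeasure (μ i)] {f : (i : ι) → X i → ℝ≥0∞}
    (hf : ∀ i, Measurable (f i)) :
    ∫⁻ x, ∏ i, f i (x i) ∂Measure.pi μ = ∏ i, ∫⁻ t, f i t ∂μ i := by
  refine (lintegral_prod_eq_prod_lintegral_of_indepFun (μ := Measure.pi μ) Finset.univ
    (fun i x => f i (x i))
    (iIndepFun_pi fun i => (hf i).aemeasurable)
    fun i => (hf i).comp (measurable_pi_apply i)).trans ?_
  exact Finset.prod_congr rfl fun i _ => (measurePreserving_eval μ i).lintegral_comp (hf i)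

lemma pi_withDensity {ι : Type*} [Fintype ι] {X : ι → Type*} [∀ i, MeasurableSpace (X i)]
    (μ : (i : ι) → Measure (X i)) [∀ i, IsProbabilityMeasure (μ i)] {f : (i : ι) → X i → ℝ≥0∞}
    (hf : ∀ i, Measurable (f i)) [∀ i, SigmaFinite ((μ i).withDensity (f i))] :
    Measure.pi (fun i => (μ i).withDensity (f i)) =
      (Measure.pi μ).withDensity fun x => ∏ i, f i (x i) := by
  refine Measure.pi_eq fun s hs => ?_
  have hind : ∀ x : (i : ι) → X i, (Set.univ.pi s).indicator (fun x => ∏ i, f i (x i)) x =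
      ∏ i, (s i).indicator (f i) (x i) := by
    intro x
    by_cases hx : x ∈ Set.univ.pi s
    · rw [Set.indicator_of_mem hx]
      exact Finset.prod_congr rfl fun i _ => (Set.indicator_of_mem (hx i trivial) _).symm
    · rw [Set.indicator_of_notMem hx]
      obtain ⟨i, hi⟩ : ∃ i, x i ∉ s i := by simpa using hx
      exact (Finset.prod_eq_zero (Finset.mem_univ i) (Set.indicator_of_notMem hi _)).symm
  rw [withDensity_apply _ (.univ_pi hs), ← lintegral_indicator (.univ_pi hs)]
  simp_rw [hind]
  rw [lintegral_pi_prod μ fun i => (hf i).indicator (hs i)]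
  exact Finset.prod_congr rfl fun i _ => by
    rw [withDensity_apply _ (hs i), lintegral_indicator (hs i)]

/-- The likelihood ratio of `N(m, v)` with respect to `N(0, v)`. -/
noncomputable def gaussianTilt (v : ℝ≥0) (m w : ℝ) : ℝ≥0∞ := eexp (m * w / v - m ^ 2 / (2 * v))

@[fun_prop]
lemma measurable_gaussianTilt (v : ℝ≥0) : Measurable (Function.uncurry (gaussianTilt v)) := by
  unfold gaussianTilt Function.uncurry
  fun_prop

lemma gaussianReal_eq_withDensity_tilt {v : ℝ≥0} (hv : v ≠ 0) (m : ℝ) :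
    gaussianReal m v = (gaussianReal 0 v).withDensity (gaussianTilt v m) := by
  have hv' : (v : ℝ) ≠ 0 := by exact_mod_cast hv
  rw [gaussianReal_of_var_ne_zero m hv, gaussianReal_of_var_ne_zero 0 hv,
    ← withDensity_mul _ (measurable_gaussianPDF 0 v) (by unfold gaussianTilt; fun_prop)]
  congr 1
  ext w
  simp only [Pi.mul_apply, gaussianPDF, gaussianTilt, eexp]
  rw [← ENNReal.ofReal_mul (gaussianPDFReal_nonneg _ _ _), gaussianPDFReal, gaussianPDFReal,
    mul_assoc _ (Real.exp _) (Real.exp _), ← Real.exp_add]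
  congr 3
  field_simp
  ring

lemma lintegral_eexp_mul_gaussianReal (v : ℝ≥0) (t : ℝ) :
    ∫⁻ w, eexp (t * w) ∂gaussianReal 0 v = eexp (v * t ^ 2 / 2) := by
  have h := mgf_gaussianReal (μ := 0) (v := v) (p := gaussianReal 0 v) (X := id) (by simp) t
  simp only [mgf, id, zero_mul, zero_add] at h
  rw [eexp, ← h, ofReal_integral_eq_lintegral_ofReal (integrable_exp_mul_gaussianReal t)
    (ae_of_all _ fun _ => (Real.exp_pos _).le)]
  rfl

lemma lintegral_gaussianTilt_mul {v : ℝ≥0} (hv : v ≠ 0) (a b : ℝ) :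
    ∫⁻ w, gaussianTilt v a w * gaussianTilt v b w ∂gaussianReal 0 v = eexp (a * b / v) := by
  have hv' : (v : ℝ) ≠ 0 := by exact_mod_cast hv
  have h : ∀ w, gaussianTilt v a w * gaussianTilt v b w =
      eexp (-(a ^ 2 + b ^ 2) / (2 * v)) * eexp ((a + b) / v * w) := by
    intro w
    rw [gaussianTilt, gaussianTilt, ← eexp_add, ← eexp_add]
    congr 1
    ring
  simp_rw [h]
  rw [lintegral_const_mul _ (by fun_prop), lintegral_eexp_mul_gaussianReal, ← eexp_add]
  congr 1
  field_simp
  ring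

lemma lintegral_eexp_sq_gaussianReal_lt_top {c : ℝ} (hc : c < 1) :
    ∫⁻ g, eexp (c * g ^ 2 / 2) ∂gaussianReal 0 1 < ∞ := by
  rw [gaussianReal_of_var_ne_zero 0 one_ne_zero,
    lintegral_withDensity_eq_lintegral_mul _ (measurable_gaussianPDF 0 1) (by fun_prop)]
  have h : ∀ g : ℝ, (gaussianPDF 0 1 * fun g => eexp (c * g ^ 2 / 2)) g =
      ENNReal.ofReal ((√(2 * Real.pi))⁻¹ * Real.exp (-((1 - c) / 2) * g ^ 2)) := by
    intro g
    simp only [Pi.mul_apply, gaussianPDF, eexp]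
    rw [← ENNReal.ofReal_mul (gaussianPDFReal_nonneg _ _ _), gaussianPDFReal,
      mul_assoc, ← Real.exp_add]
    congr 2
    · simp
    · congr 1
      simp
      ring
  simp_rw [h]
  exact ((integrable_exp_neg_mul_sq (by linarith)).const_mul _).lintegral_lt_top

/-- The second moment bound: a mixture of measures with densities `L x` with respect to `Q` is
controlled by `Q` and the second moment of the mixed density. -/
lemma bind_withDensity_apply_le {X Ω : Type*} [MeasurableSpace X] [MeasurableSpace Ω]
    (μ : Measure X) (Q : Measure Ω) [SFinite μ] [SFinite Q] {L : X → Ω → ℝ≥0∞}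
    (hL : Measurable (Function.uncurry L)) {B : Set Ω} (hB : MeasurableSet B) :
    ∫⁻ x, Q.withDensity (L x) B ∂μ ≤
      Q B ^ (1 / 2 : ℝ) * (∫⁻ x, ∫⁻ y, ∫⁻ ω, L x ω * L y ω ∂Q ∂μ ∂μ) ^ (1 / 2 : ℝ) := by
  have hLx (x : X) : Measurable (L x) := hL.of_uncurry_left
  have hLω (ω : Ω) : Measurable fun x => L x ω := hL.of_uncurry_right
  have hmix : Measurable fun ω => ∫⁻ x, L x ω ∂μ := hL.lintegral_prod_left'
  have hind : Measurable (B.indicator (1 : Ω → ℝ≥0∞)) := measurable_one.indicator hB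
  have hfirst : ∫⁻ x, Q.withDensity (L x) B ∂μ =
      ∫⁻ ω, ((B.indicator 1 : Ω → ℝ≥0∞) * fun ω => ∫⁻ x, L x ω ∂μ) ω ∂Q := by
    have h (x : X) : Q.withDensity (L x) B = ∫⁻ ω, B.indicator 1 ω * L x ω ∂Q := by
      rw [withDensity_apply _ hB, ← lintegral_indicator hB]
      refine lintegral_congr fun ω => ?_
      by_cases hω : ω ∈ B <;> simp [hω]
    simp_rw [h]
    rw [lintegral_lintegral_swap (by
      exact ((hind.comp measurable_snd).mul hL).aemeasurable)]
    exact lintegral_congr fun ω => lintegral_const_mul _ (hLω ω)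
  have hsq : ∫⁻ ω, (∫⁻ x, L x ω ∂μ) ^ (2 : ℝ) ∂Q =
      ∫⁻ x, ∫⁻ y, ∫⁻ ω, L x ω * L y ω ∂Q ∂μ ∂μ := by
    have h (x : X) : ∫⁻ y, ∫⁻ ω, L x ω * L y ω ∂Q ∂μ =
        ∫⁻ ω, L x ω * ∫⁻ y, L y ω ∂μ ∂Q := by
      rw [lintegral_lintegral_swap (by
        exact (((hLx x).comp measurable_snd).mul hL).aemeasurable)]
      exact lintegral_congr fun ω => lintegral_const_mul _ (hLω ω)
    simp_rw [h]
    rw [lintegral_lintegral_swap (by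
      exact (hL.mul (hmix.comp measurable_snd)).aemeasurable)]
    refine lintegral_congr fun ω => ?_
    rw [lintegral_mul_const _ (hLω ω), ENNReal.rpow_two, sq]
  have hindsq : ∫⁻ ω, B.indicator (1 : Ω → ℝ≥0∞) ω ^ (2 : ℝ) ∂Q = Q B := by
    rw [← lintegral_indicator_one hB]
    refine lintegral_congr fun ω => ?_
    by_cases hω : ω ∈ B <;> simp [hω]
  rw [hfirst, ← hsq, ← hindsq]
  exact ENNReal.lintegral_mul_le_Lp_mul_Lq Q Real.HolderConjugate.two_two hind.aemeasurable
    hmix.aemeasurable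

lemma map_add_pi_gaussianReal {ι : Type*} [Fintype ι] {v : ℝ≥0} (hv : v ≠ 0) (m : ι → ℝ) :
    (Measure.pi fun _ : ι => gaussianReal 0 v).map (fun W i => m i + W i) =
      (Measure.pi fun _ : ι => gaussianReal 0 v).withDensity
        fun W => ∏ i, gaussianTilt v (m i) (W i) := by
  have hmap (i : ι) : (gaussianReal 0 v).map (m i + ·) = gaussianReal (m i) v := by
    rw [gaussianReal_map_const_add, zero_add]
  have htilt (i : ι) : IsProbabilityMeasure ((gaussianReal 0 v).withDensity
      (gaussianTilt v (m i))) := by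
    rw [← gaussianReal_eq_withDensity_tilt hv]
    infer_instance
  rw [← pi_withDensity _ fun i => (measurable_gaussianTilt v).of_uncurry_left,
    Measure.pi_map_pi (f := fun i t => m i + t) fun i => by fun_prop]
  congr 1
  ext1 i
  rw [hmap, gaussianReal_eq_withDensity_tilt hv]

lemma lintegral_prod_gaussianTilt_mul {ι : Type*} [Fintype ι] {v : ℝ≥0} (hv : v ≠ 0)
    (a b : ι → ℝ) :
    ∫⁻ W, (∏ i, gaussianTilt v (a i) (W i)) * ∏ i, gaussianTilt v (b i) (W i)
      ∂(Measure.pi fun _ : ι => gaussianReal 0 v) = eexp ((∑ i, a i * b i) / v) := by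
  simp_rw [← Finset.prod_mul_distrib]
  rw [lintegral_pi_prod _ (f := fun i w => gaussianTilt v (a i) w * gaussianTilt v (b i) w)
    fun i => (measurable_gaussianTilt v).of_uncurry_left.mul
      (measurable_gaussianTilt v).of_uncurry_left, Finset.sum_div, eexp_sum]
  exact Finset.prod_congr rfl fun i _ => lintegral_gaussianTilt_mul hv _ _

/-- The uniform measure on `{-1/√n, 1/√n}`. -/
noncomputable def radLaw (n : ℕ) : Measure ℝ :=
  ((PMF.uniformOfFintype Bool).map
    fun b => if b then (Real.sqrt n)⁻¹ else -(Real.sqrt n)⁻¹).toMeasure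

instance (n : ℕ) : IsProbabilityMeasure (radLaw n) := by
  unfold radLaw
  infer_instance

lemma radPrior_eq (n : ℕ) : radPrior n = Measure.pi fun _ : Fin n => radLaw n := rfl

instance (n : ℕ) : IsProbabilityMeasure (radPrior n) := by
  rw [radPrior_eq]
  infer_instance

lemma lintegral_radLaw (n : ℕ) {f : ℝ → ℝ≥0∞} (hf : Measurable f) :
    ∫⁻ s, f s ∂radLaw n = (f (√n)⁻¹ + f (-(√n)⁻¹)) / 2 := by
  rw [radLaw, ← PMF.toMeasure_map _ _ (measurable_of_finite _),
    lintegral_map hf (measurable_of_finite _), lintegral_fintype]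
  simp [ENNReal.div_eq_inv_mul, mul_add, mul_comm]

lemma lintegral_eexp_mul_radLaw_le (n : ℕ) (t : ℝ) :
    ∫⁻ s, eexp (t * s) ∂radLaw n ≤ eexp (t ^ 2 / (2 * n)) := by
  rw [lintegral_radLaw n (by fun_prop)]
  have h : (eexp (t * (√n)⁻¹) + eexp (t * -(√n)⁻¹)) / 2 =
      ENNReal.ofReal (Real.cosh (t * (√n)⁻¹)) := by
    rw [eexp, eexp, ← ENNReal.ofReal_add (Real.exp_pos _).le (Real.exp_pos _).le, Real.cosh_eq,
      ENNReal.ofReal_div_of_pos two_pos, mul_neg]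
    simp
  rw [h, eexp]
  refine ENNReal.ofReal_le_ofReal ((Real.cosh_le_exp_half_sq _).trans_eq ?_)
  rw [mul_pow, inv_pow, Real.sq_sqrt n.cast_nonneg]
  congr 1
  ring

lemma lintegral_eexp_dot_radPrior_le {n : ℕ} (hn : n ≠ 0) (t : ℝ) :
    ∫⁻ x, ∫⁻ y, eexp (t * ∑ i, x i * y i) ∂radPrior n ∂radPrior n ≤ eexp (t ^ 2 / (2 * n)) := by
  have hn' : (n : ℝ) ≠ 0 := by exact_mod_cast hn
  have hinner (x : Fin n → ℝ) : ∫⁻ y, eexp (t * ∑ i, x i * y i) ∂radPrior n ≤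
      ∏ i, eexp ((t * x i) ^ 2 / (2 * n)) := by
    have h (y : Fin n → ℝ) : eexp (t * ∑ i, x i * y i) = ∏ i, eexp (t * x i * y i) := by
      rw [Finset.mul_sum, eexp_sum]
      simp_rw [mul_assoc]
    simp_rw [h]
    rw [radPrior_eq, lintegral_pi_prod _ (f := fun i s => eexp (t * x i * s))
      fun i => by fun_prop]
    exact Finset.prod_le_prod' fun i _ => lintegral_eexp_mul_radLaw_le n _
  refine (lintegral_mono hinner).trans_eq ?_
  rw [radPrior_eq, lintegral_pi_prod _ (f := fun _ s => eexp ((t * s) ^ 2 / (2 * n)))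
    fun i => by fun_prop]
  have hcoord : ∫⁻ s, eexp ((t * s) ^ 2 / (2 * n)) ∂radLaw n = eexp (t ^ 2 / (2 * n) / n) := by
    have h (s : ℝ) (hs : s ^ 2 = (n : ℝ)⁻¹) :
        eexp ((t * s) ^ 2 / (2 * n)) = eexp (t ^ 2 / (2 * n) / n) := by
      rw [mul_pow, hs]
      congr 1
      ring
    rw [lintegral_radLaw n (by fun_prop), h _ (by simp), h _ (by simp), ← two_mul,
      mul_comm, ENNReal.mul_div_cancel_right two_ne_zero ENNReal.ofNat_ne_top]
  simp_rw [hcoord]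
  rw [← eexp_sum]
  congr 1
  simp [field]

/-- By linearizing the square with an independent standard Gaussian, the exponential moment of the
squared overlap is bounded by a Gaussian integral which does not depend on `n`. -/
lemma lintegral_eexp_sq_overlap_le {n : ℕ} (hn : n ≠ 0) (lam : ℝ) :
    ∫⁻ x, ∫⁻ y, eexp (n * lam ^ 2 / 2 * (∑ i, x i * y i) ^ 2) ∂radPrior n ∂radPrior n ≤
      ∫⁻ g, eexp (lam ^ 2 * g ^ 2 / 2) ∂gaussianReal 0 1 := by
  have hn' : (n : ℝ) ≠ 0 := by exact_mod_cast hn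
  have h (x y : Fin n → ℝ) : eexp (n * lam ^ 2 / 2 * (∑ i, x i * y i) ^ 2) =
      ∫⁻ g, eexp (lam * √n * g * ∑ i, x i * y i) ∂gaussianReal 0 1 := by
    simp_rw [mul_right_comm _ _ (∑ i, x i * y i)]
    rw [lintegral_eexp_mul_gaussianReal, mul_pow, mul_pow, Real.sq_sqrt n.cast_nonneg]
    congr 1
    push_cast
    ring
  simp_rw [h]
  calc
    _ = ∫⁻ x, ∫⁻ g, ∫⁻ y, eexp (lam * √n * g * ∑ i, x i * y i) ∂radPrior n
          ∂gaussianReal 0 1 ∂radPrior n := by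
      refine lintegral_congr fun x => lintegral_lintegral_swap ?_
      unfold Function.uncurry
      fun_prop
    _ = ∫⁻ g, ∫⁻ x, ∫⁻ y, eexp (lam * √n * g * ∑ i, x i * y i) ∂radPrior n
          ∂radPrior n ∂gaussianReal 0 1 := by
      refine lintegral_lintegral_swap (Measurable.aemeasurable ?_)
      refine Measurable.lintegral_prod_right' (f := fun p : ((Fin n → ℝ) × ℝ) × (Fin n → ℝ) =>
        eexp (lam * √n * p.1.2 * ∑ i, p.1.1 i * p.2 i)) ?_
      fun_prop
    _ ≤ _ := by
      refine lintegral_mono fun g => (lintegral_eexp_dot_radPrior_le hn _).trans_eq ?_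
      rw [mul_pow, mul_pow, Real.sq_sqrt n.cast_nonneg]
      congr 1
      field_simp

/-- The symmetrization map sending i.i.d. Gaussian noise to Gaussian Wigner noise. -/
def symmetrize (n : ℕ) (W : Fin n × Fin n → ℝ) : Fin n → Fin n → ℝ :=
  fun i j => W (i, j) + W (j, i)

lemma measurable_symmetrize_s7 (n : ℕ) : Measurable (symmetrize n) := by
  unfold symmetrize
  fun_prop

lemma gwigUnspiked_eq (n : ℕ) : gwigUnspiked n =
    (Measure.pi fun _ : Fin n × Fin n => gaussianReal 0 (1 / (2 * (n : ℝ≥0)))).map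
      (symmetrize n) := rfl

instance (n : ℕ) : IsProbabilityMeasure (gwigUnspiked n) := by
  rw [gwigUnspiked_eq]
  exact Measure.isProbabilityMeasure_map (measurable_symmetrize_s7 n).aemeasurable

lemma gwigSpiked_apply (n : ℕ) (lam : ℝ) (prior : Measure (Fin n → ℝ))
    {A : Set (Fin n → Fin n → ℝ)} (hA : MeasurableSet A) :
    gwigSpiked n lam prior A =
      ∫⁻ x, (gwigUnspiked n).map (fun Y i j => lam * (x i * x j) + Y i j) A ∂prior := by
  refine Measure.bind_apply hA (Measurable.aemeasurable ?_)
  refine Measure.measurable_of_measurable_coe _ fun s hs => ?_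
  have hadd : Measurable fun p : (Fin n → ℝ) × (Fin n → Fin n → ℝ) =>
      fun i j => lam * (p.1 i * p.1 j) + p.2 i j := by fun_prop
  have h (x : Fin n → ℝ) : (gwigUnspiked n).map (fun Y i j => lam * (x i * x j) + Y i j) s =
      gwigUnspiked n (Prod.mk x ⁻¹' ((fun p : (Fin n → ℝ) × (Fin n → Fin n → ℝ) =>
        fun i j => lam * (p.1 i * p.1 j) + p.2 i j) ⁻¹' s)) :=
    Measure.map_apply (by fun_prop) hs
  simp_rw [h]
  exact measurable_measure_prodMk_left (hadd hs)

lemma map_add_gwigUnspiked {n : ℕ} (hn : n ≠ 0) (lam : ℝ) (x : Fin n → ℝ) :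
    (gwigUnspiked n).map (fun Y i j => lam * (x i * x j) + Y i j) =
      ((Measure.pi fun _ : Fin n × Fin n => gaussianReal 0 (1 / (2 * (n : ℝ≥0)))).withDensity
        fun W => ∏ p, gaussianTilt (1 / (2 * (n : ℝ≥0))) (lam / 2 * (x p.1 * x p.2)) (W p)).map
        (symmetrize n) := by
  rw [← map_add_pi_gaussianReal (by simpa using hn), gwigUnspiked_eq,
    Measure.map_map (by fun_prop) (measurable_symmetrize_s7 n),
    Measure.map_map (measurable_symmetrize_s7 n) (by fun_prop)]
  congr 1
  ext W i j
  simp only [symmetrize, Function.comp_apply]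
  ring

lemma gwigSpiked_radPrior_apply_le {n : ℕ} (hn : n ≠ 0) (lam : ℝ)
    {A : Set (Fin n → Fin n → ℝ)} (hA : MeasurableSet A) :
    gwigSpiked n lam (radPrior n) A ≤ gwigUnspiked n A ^ (1 / 2 : ℝ) *
      (∫⁻ g, eexp (lam ^ 2 * g ^ 2 / 2) ∂gaussianReal 0 1) ^ (1 / 2 : ℝ) := by
  have hv : 1 / (2 * (n : ℝ≥0)) ≠ 0 := by simpa using hn
  have hoverlap (x y : Fin n → ℝ) :
      (∑ p : Fin n × Fin n, lam / 2 * (x p.1 * x p.2) * (lam / 2 * (y p.1 * y p.2))) /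
        (1 / (2 * (n : ℝ≥0)) : ℝ≥0) = n * lam ^ 2 / 2 * (∑ i, x i * y i) ^ 2 := by
    rw [sq (∑ i, x i * y i), Fintype.sum_mul_sum, ← Fintype.sum_prod_type', Finset.mul_sum,
      Finset.sum_div]
    refine Finset.sum_congr rfl fun p _ => ?_
    push_cast
    field_simp
  rw [gwigSpiked_apply n lam _ hA]
  simp_rw [map_add_gwigUnspiked hn, Measure.map_apply (measurable_symmetrize_s7 n) hA]
  refine (bind_withDensity_apply_le _ _ ?_ (measurable_symmetrize_s7 n hA)).trans ?_
  · unfold Function.uncurry gaussianTilt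
    fun_prop
  · simp_rw [lintegral_prod_gaussianTilt_mul hv, hoverlap]
    rw [gwigUnspiked_eq, Measure.map_apply (measurable_symmetrize_s7 n) hA]
    gcongr
    exact lintegral_eexp_sq_overlap_le hn lam

/-- For the i.i.d. Rademacher prior and any `0 ≤ λ < 1`, the spiked Gaussian Wigner
sequence is contiguous to the unspiked sequence. -/
theorem stmt_7 (lam : ℝ) (hlam0 : 0 ≤ lam) (hlam1 : lam < 1) :
    Contiguous (fun n => gwigSpiked n lam (radPrior n)) (fun n => gwigUnspiked n) := by
  intro A hA hQ
  set C := (∫⁻ g, eexp (lam ^ 2 * g ^ 2 / 2) ∂gaussianReal 0 1) ^ (1 / 2 : ℝ)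
  have hC : C ≠ ∞ := ENNReal.rpow_ne_top_of_nonneg (by norm_num)
    (lintegral_eexp_sq_gaussianReal_lt_top (by nlinarith)).ne
  have hbound : Tendsto (fun n => gwigUnspiked n (A n) ^ (1 / 2 : ℝ) * C) atTop (𝓝 0) := by
    have h := ENNReal.Tendsto.mul_const (b := C)
      (((ENNReal.continuous_rpow_const (y := 1 / 2)).tendsto 0).comp hQ) (.inr hC)
    simpa using h
  refine tendsto_of_tendsto_of_tendsto_of_le_of_le' tendsto_const_nhds hbound
    (.of_forall fun _ => zero_le) ?_
  filter_upwards [eventually_ne_atTop 0] with n hn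
  exact gwigSpiked_radPrior_apply_le hn lam (hA n)
end

section
/- For ρ ∈ (0,1], define k_ρ(t) = log(1 − ρ² + ρ² cosh(t/ρ)) for t ∈ ℝ; this is the cumulant generating function of the product of two independent copies of the normalized sparse Rademacher variable π = ρ^{−1/2}·ℛ(ρ). (a) If ρ ≥ 1/√3, then k_ρ(t) ≤ t²/2 for all t ∈ ℝ, i.e. the product π·π' is sub-Gaussian with variance proxy 1. (b) If 0 < ρ < 1/√3, then there exists t ∈ ℝ with k_ρ(t) > t²/2, so the optimal variance proxy σ* satisfies σ* > 1. -/
open Real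

/-- The quantitative form of `3 ^ n ≤ (2 * n + 1)‼`, with the double factorial written as
`(2 * n + 2)! / (2 ^ (n + 1) * (n + 1)!)`. -/
lemma two_pow_mul_factorial_le_pow_mul_factorial {p : ℝ} (hp : 1 / 3 ≤ p) (n : ℕ) :
    (2 : ℝ) ^ (n + 1) * (n + 1).factorial ≤ p ^ n * (2 * (n + 1)).factorial := by
  induction n with
  | zero => norm_num
  | succ n ih =>
    have hfac : ((2 * (n + 1 + 1)).factorial : ℝ)
        = (2 * n + 4) * (2 * n + 3) * (2 * (n + 1)).factorial := by
      rw [show 2 * (n + 1 + 1) = 2 * (n + 1) + 1 + 1 by ring, Nat.factorial_succ,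
        Nat.factorial_succ]
      push_cast
      ring
    have hstep : 1 ≤ p * (2 * n + 3) := by
      have hn : (0 : ℝ) ≤ n := n.cast_nonneg
      nlinarith
    rw [hfac, Nat.factorial_succ (n + 1)]
    push_cast
    calc (2 : ℝ) ^ (n + 1 + 1) * ((n + 1 + 1) * (n + 1).factorial)
        = (2 * n + 4) * (1 * (2 ^ (n + 1) * (n + 1).factorial)) := by ring
      _ ≤ (2 * n + 4) * ((p * (2 * n + 3)) * (p ^ n * (2 * (n + 1)).factorial)) := by gcongr
      _ = p ^ (n + 1) * ((2 * n + 4) * (2 * n + 3) * (2 * (n + 1)).factorial) := by ring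

lemma one_sub_add_mul_cosh_le_exp {p : ℝ} (hp : 1 / 3 ≤ p) (x : ℝ) :
    1 - p + p * cosh x ≤ exp (p * x ^ 2 / 2) := by
  have hexp : HasSum (fun n : ℕ => (p * x ^ 2 / 2) ^ n / n.factorial) (exp (p * x ^ 2 / 2)) := by
    rw [Real.exp_eq_exp_ℝ]
    exact NormedSpace.expSeries_div_hasSum_exp _
  refine hasSum_le (fun n => ?_)
    ((hasSum_ite_eq (0 : ℕ) (1 - p)).add ((Real.hasSum_cosh x).mul_left p)) hexp
  cases n with
  | zero => simp
  | succ n =>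
    have hfac := two_pow_mul_factorial_le_pow_mul_factorial hp n
    have hp0 : 0 < p := by linarith
    have hx : 0 ≤ p * x ^ (2 * (n + 1)) := mul_nonneg hp0.le (by rw [pow_mul]; positivity)
    simp only [Nat.add_eq_zero_iff, one_ne_zero, and_false, if_false, zero_add]
    rw [div_pow, div_div, ← mul_div_assoc, div_le_div_iff₀ (by positivity) (by positivity)]
    calc p * x ^ (2 * (n + 1)) * (2 ^ (n + 1) * (n + 1).factorial)
        ≤ p * x ^ (2 * (n + 1)) * (p ^ n * (2 * (n + 1)).factorial) := by gcongr
      _ = (p * x ^ 2) ^ (n + 1) * (2 * (n + 1)).factorial := by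
        rw [mul_pow, ← pow_mul]
        ring

lemma one_add_sq_add_pow_four_le_cosh (x : ℝ) : 1 + x ^ 2 / 2 + x ^ 4 / 24 ≤ cosh x := by
  have h := sum_le_hasSum (Finset.range 3)
    (fun n _ => div_nonneg (by rw [pow_mul]; positivity) (by positivity)) (Real.hasSum_cosh x)
  simpa [Finset.sum_range_succ, Nat.factorial] using h

lemma exp_lt_one_sub_add_mul_cosh {p x : ℝ} (hp0 : 0 < p) (hp : p < 1 / 3)
    (hx : x ^ 2 = 1 - 3 * p) : exp (p * x ^ 2 / 2) < 1 - p + p * cosh x := by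
  set u := 1 - 3 * p with hu
  have hu0 : 0 < u := by linarith
  have hcosh := mul_le_mul_of_nonneg_left (one_add_sq_add_pow_four_le_cosh x) hp0.le
  have hexp := Real.exp_bound' (x := p * x ^ 2 / 2) (by positivity) (by rw [hx]; nlinarith)
    (n := 3) (by norm_num)
  norm_num [Finset.sum_range_succ, Nat.factorial] at hexp
  rw [show x ^ 4 = (x ^ 2) ^ 2 by ring, hx] at hcosh
  rw [hx] at hexp ⊢
  have hgap : 0 < p * u ^ 3 * (1 - 2 / 3 * p ^ 2) := by
    have : 0 < 1 - 2 / 3 * p ^ 2 := by nlinarith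
    positivity
  have hfactor : p * (1 + u / 2 + u ^ 2 / 24) - p
      - (p * u / 2 + (p * u / 2) ^ 2 / 2 + (p * u / 2) ^ 3 * 4 / 18)
      = p * u ^ 3 * (1 - 2 / 3 * p ^ 2) / 24 := by
    rw [hu]
    ring
  linarith

/-- Sparse Rademacher sub-Gaussianity. For `ρ ∈ (0,1]`, let
`k_ρ(t) = log(1 - ρ² + ρ² cosh(t/ρ))` be the cumulant generating function of the
product of two independent copies of the normalized sparse Rademacher variable.
(a) If `ρ ≥ 1/√3` then `k_ρ(t) ≤ t²/2` for all `t` (variance proxy 1).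
(b) If `ρ < 1/√3` then `k_ρ(t) > t²/2` for some `t` (optimal proxy `σ* > 1`). -/
theorem stmt_8 (ρ : ℝ) (hρ0 : 0 < ρ) (hρ1 : ρ ≤ 1) :
    (1 / Real.sqrt 3 ≤ ρ →
      ∀ t : ℝ, Real.log (1 - ρ ^ 2 + ρ ^ 2 * Real.cosh (t / ρ)) ≤ t ^ 2 / 2) ∧
    (ρ < 1 / Real.sqrt 3 →
      ∃ t : ℝ, t ^ 2 / 2 < Real.log (1 - ρ ^ 2 + ρ ^ 2 * Real.cosh (t / ρ))) := by
  have hsq (t : ℝ) : ρ ^ 2 * (t / ρ) ^ 2 / 2 = t ^ 2 / 2 := by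
    field_simp
  constructor
  · intro h t
    have hp : 1 / 3 ≤ ρ ^ 2 := by
      calc (1 / 3 : ℝ) = (1 / √3) ^ 2 := by norm_num [div_pow]
        _ ≤ ρ ^ 2 := by gcongr
    have hpos : 0 < 1 - ρ ^ 2 + ρ ^ 2 * cosh (t / ρ) := by
      nlinarith [Real.one_le_cosh (t / ρ), sq_nonneg ρ]
    rw [Real.log_le_iff_le_exp hpos, ← hsq t]
    exact one_sub_add_mul_cosh_le_exp hp _
  · intro h
    have hp : ρ ^ 2 < 1 / 3 := by
      calc ρ ^ 2 < (1 / √3) ^ 2 := by gcongr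
        _ = 1 / 3 := by norm_num [div_pow]
    refine ⟨ρ * √(1 - 3 * ρ ^ 2), ?_⟩
    have hpos : 0 < 1 - ρ ^ 2 + ρ ^ 2 * cosh (ρ * √(1 - 3 * ρ ^ 2) / ρ) := by
      nlinarith [Real.one_le_cosh (ρ * √(1 - 3 * ρ ^ 2) / ρ), sq_nonneg ρ]
    rw [Real.lt_log_iff_exp_lt hpos, ← hsq]
    refine exp_lt_one_sub_add_mul_cosh (by positivity) hp ?_
    rw [mul_div_cancel_left₀ _ hρ0.ne', Real.sq_sqrt (by linarith)]
end

section
/- Let p : ℝ → ℝ be a continuously differentiable probability density with p(w) > 0 for every w, with mean zero (∫ w·p(w) dw = 0) and unit variance (∫ w²·p(w) dw = 1). Suppose the Fisher information F = ∫ p'(w)²/p(w) dw is finite and that w ↦ w·p'(w) is integrable. Then F ≥ 1, with equality if and only if p is the standard Gaussian density p(w) = (2π)^{−1/2} exp(−w²/2). -/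
open MeasureTheory Real

/-- Integration by parts of a density of total mass one against the identity. -/
lemma integral_id_mul_deriv_eq_neg_one {p : ℝ → ℝ} (hp : Differentiable ℝ p)
    (hpint : Integrable p) (hone : ∫ w, p w = 1) (hmint : Integrable (fun w => w * p w))
    (hwp' : Integrable (fun w => w * deriv p w)) :
    ∫ w, w * deriv p w = -1 := by
  have hderiv (w : ℝ) : HasDerivAt (fun w => w * p w) (p w + w * deriv p w) w := by
    simpa using (hasDerivAt_id' w).fun_mul (hp w).hasDerivAt
  have h := integral_eq_zero_of_hasDerivAt_of_integrable hderiv (hpint.add hwp') hmint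
  rw [integral_add hpint hwp', hone] at h
  linarith

lemma sq_deriv_add_id_mul_div_eq {p : ℝ → ℝ} (hpos : ∀ w, 0 < p w) (w : ℝ) :
    (deriv p w + w * p w) ^ 2 / p w =
      (deriv p w) ^ 2 / p w + 2 * (w * deriv p w) + w ^ 2 * p w := by
  have := (hpos w).ne'
  field_simp
  ring

/-- A probability density satisfies `deriv p w + w * p w = 0` for all `w` exactly when it is the standard Gaussian. -/
lemma deriv_add_id_mul_eq_zero_iff {p : ℝ → ℝ} (hp : Differentiable ℝ p)
    (hone : ∫ w, p w = 1) :
    (∀ w, deriv p w + w * p w = 0) ↔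
      ∀ w, p w = (Real.sqrt (2 * Real.pi))⁻¹ * Real.exp (-w ^ 2 / 2) := by
  constructor
  · intro h
    have hderiv (w : ℝ) : HasDerivAt (fun w => p w * exp (w ^ 2 / 2)) 0 w := by
      have hsq : HasDerivAt (fun w : ℝ => w ^ 2 / 2) w w := by
        simpa using ((hasDerivAt_id' w).fun_pow 2).div_const 2
      refine ((hp w).hasDerivAt.fun_mul hsq.exp).congr_deriv ?_
      linear_combination exp (w ^ 2 / 2) * h w
    have hconst (w : ℝ) : p w = p 0 * exp (-w ^ 2 / 2) := by
      have hw := is_const_of_deriv_eq_zero (fun w => (hderiv w).differentiableAt)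
        (fun w => (hderiv w).deriv) w 0
      have hexp : exp (w ^ 2 / 2) * exp (-w ^ 2 / 2) = 1 := by
        rw [← exp_add, neg_div, add_neg_cancel, exp_zero]
      simp only [ne_eq, OfNat.ofNat_ne_zero, not_false_eq_true, zero_pow, zero_div, exp_zero,
        mul_one] at hw
      rw [← hw, mul_assoc, hexp, mul_one]
    have hgauss : ∫ w : ℝ, exp (-w ^ 2 / 2) = √(2 * π) := by
      have := integral_gaussian (1 / 2)
      rw [show π / (1 / 2) = 2 * π by ring] at this
      rw [← this]
      congr with w
      ring_nf
    have hmass : p 0 * √(2 * π) = 1 := by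
      rw [← hgauss, ← integral_const_mul, ← hone]
      exact integral_congr_ae (.of_forall fun w => (hconst w).symm)
    intro w
    rw [hconst w, eq_inv_of_mul_eq_one_left hmass]
  · intro h w
    have hsq : HasDerivAt (fun w : ℝ => -w ^ 2 / 2) (-w) w := by
      simpa [neg_div] using ((hasDerivAt_id' w).fun_pow 2).fun_neg.div_const 2
    have hd := (hsq.exp.const_mul (√(2 * π))⁻¹).deriv
    rw [← funext h] at hd
    rw [hd, h w]
    ring


/-- Gaussian noise is the hardest: if `p` is a continuously differentiable,
everywhere-positive probability density on `ℝ` with mean zero and unit variance,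
finite Fisher information `F = ∫ p'(w)²/p(w) dw`, and `w ↦ w p'(w)` integrable,
then `F ≥ 1`, with equality iff `p` is the standard Gaussian density. -/
theorem stmt_10 (p : ℝ → ℝ) (hp : ContDiff ℝ 1 p) (hpos : ∀ w, 0 < p w)
    (hpint : Integrable p) (hone : ∫ w, p w = 1)
    (hmint : Integrable (fun w => w * p w)) (hmean : ∫ w, w * p w = 0)
    (hvint : Integrable (fun w => w ^ 2 * p w)) (hvar : ∫ w, w ^ 2 * p w = 1)
    (hF : Integrable (fun w => (deriv p w) ^ 2 / p w))
    (hwp' : Integrable (fun w => w * deriv p w)) :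
    1 ≤ ∫ w, (deriv p w) ^ 2 / p w ∧
      ((∫ w, (deriv p w) ^ 2 / p w) = 1 ↔
        ∀ w, p w = (Real.sqrt (2 * Real.pi))⁻¹ * Real.exp (-w ^ 2 / 2)) := by
  have hdiff : Differentiable ℝ p := hp.differentiable one_ne_zero
  have hsplit := sq_deriv_add_id_mul_div_eq hpos
  have hnonneg (w : ℝ) : 0 ≤ (deriv p w + w * p w) ^ 2 / p w :=
    div_nonneg (sq_nonneg _) (hpos w).le
  have hint : Integrable (fun w => (deriv p w + w * p w) ^ 2 / p w) := by
    simp_rw [hsplit]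
    exact (hF.add (hwp'.const_mul 2)).add hvint
  have hval : ∫ w, (deriv p w + w * p w) ^ 2 / p w = (∫ w, (deriv p w) ^ 2 / p w) - 1 := by
    simp_rw [hsplit]
    rw [integral_add (by exact hF.add (hwp'.const_mul 2)) hvint, integral_add hF (hwp'.const_mul 2),
      integral_const_mul, hvar, integral_id_mul_deriv_eq_neg_one hdiff hpint hone hmint hwp']
    ring
  have hcont : Continuous (fun w => (deriv p w + w * p w) ^ 2 / p w) :=
    (((hp.continuous_deriv le_rfl).add (continuous_id.mul hp.continuous)).pow 2).div
      hp.continuous fun w => (hpos w).ne'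
  refine ⟨by linarith [integral_nonneg (μ := volume) (Pi.le_def.2 hnonneg)], ?_⟩
  rw [← deriv_add_id_mul_eq_zero_iff hdiff hone, ← sub_eq_zero, ← hval,
    integral_eq_zero_iff_of_nonneg hnonneg hint, hcont.ae_eq_iff_eq volume continuous_zero,
    funext_iff]
  simp [(hpos _).ne']
end

section
/- Fix n, N ≥ 1, β ∈ (−1, 1), and a probability measure 𝒳_n supported on the unit sphere of ℝⁿ. Let Q be the law of an N-tuple (y_1, …, y_N) of i.i.d. standard Gaussian vectors in ℝⁿ, and let P be the mixture over x ~ 𝒳_n of the law of an N-tuple of i.i.d. vectors each distributed as g + (√(1+β) − 1)·⟨g, x⟩·x with g a standard Gaussian vector in ℝⁿ (so each sample has law N(0, I + β x xᵀ)). Then P is absolutely continuous with respect to Q and ∫ (dP/dQ)² dQ = E_{x, x' ~ 𝒳_n}[ (1 − β²⟨x, x'⟩²)^{−N/2} ], where x, x' are two independent draws from 𝒳_n. -/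
open MeasureTheory Filter Topology ProbabilityTheory
open scoped ENNReal NNReal

/-- The law of a standard Gaussian vector in `ℝⁿ`. -/
noncomputable def stdGaussVec (n : ℕ) : Measure (Fin n → ℝ) :=
  Measure.pi fun _ : Fin n => gaussianReal 0 1

instance (n : ℕ) : IsProbabilityMeasure (stdGaussVec n) := by
  unfold stdGaussVec; infer_instance

/-- The unspiked Wishart sample law: `N` i.i.d. standard Gaussian vectors in `ℝⁿ`. -/
noncomputable def wishartUnspiked (n N : ℕ) : Measure (Fin N → Fin n → ℝ) :=
  Measure.pi fun _ : Fin N => stdGaussVec n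

/-- The spiked Wishart sample law: mixture over `x ~ 𝒳` of `N` i.i.d. samples each
distributed as `g + (√(1+β) - 1) ⟨g,x⟩ x` for standard Gaussian `g` (so each sample
has law `N(0, I + β x xᵀ)` when `x` is a unit vector). -/
noncomputable def wishartSpiked (n N : ℕ) (β : ℝ) (prior : Measure (Fin n → ℝ)) :
    Measure (Fin N → Fin n → ℝ) :=
  prior.bind fun x =>
    (wishartUnspiked n N).map fun G j =>
      G j + ((Real.sqrt (1 + β) - 1) * ∑ i, G j i * x i) • x

theorem lintegral_pi_prod_eq_prod {n : ℕ} {E : Fin n → Type*}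
    {mE : ∀ i, MeasurableSpace (E i)} (μ : (i : Fin n) → Measure (E i)) [∀ i, SigmaFinite (μ i)]
    {f : (i : Fin n) → E i → ℝ≥0∞} (hf : ∀ i, Measurable (f i)) :
    ∫⁻ x, ∏ i, f i (x i) ∂(Measure.pi μ) = ∏ i, ∫⁻ x, f i x ∂(μ i) := by
  induction n with
  | zero => simp
  | succ n ih =>
    have hm : Measurable fun y : (i : Fin n) → E i.succ => ∏ i, f i.succ (y i) :=
      Finset.measurable_prod _ fun i _ => (hf i.succ).comp (measurable_pi_apply i)
    have h := (measurePreserving_piFinSuccAbove μ 0).symm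
    rw [← h.lintegral_comp_emb (MeasurableEquiv.measurableEmbedding _), Fin.prod_univ_succ,
      ← ih (fun i => μ i.succ) fun i => hf i.succ,
      ← lintegral_prod_mul (hf 0).aemeasurable hm.aemeasurable]
    refine lintegral_congr fun x => ?_
    simp only [MeasurableEquiv.piFinSuccAbove_symm_apply, Fin.insertNthEquiv, Fin.prod_univ_succ,
      Fin.insertNth_zero, Equiv.coe_fn_mk, Fin.cons_succ, Fin.cons_zero]
    rfl

theorem pi_withDensity_eq {n : ℕ} {E : Fin n → Type*}
    {mE : ∀ i, MeasurableSpace (E i)} (μ : (i : Fin n) → Measure (E i)) [∀ i, SigmaFinite (μ i)]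
    {f : (i : Fin n) → E i → ℝ≥0∞} (hf : ∀ i, Measurable (f i))
    [∀ i, SigmaFinite ((μ i).withDensity (f i))] :
    Measure.pi (fun i => (μ i).withDensity (f i))
      = (Measure.pi μ).withDensity fun x => ∏ i, f i (x i) := by
  refine Measure.pi_eq fun s hs => ?_
  rw [withDensity_apply _ (.univ_pi hs), ← lintegral_indicator (.univ_pi hs)]
  have h : (Set.univ.pi s).indicator (fun x : (i : Fin n) → E i => ∏ i, f i (x i))
      = fun x => ∏ i, (s i).indicator (f i) (x i) := by
    ext x
    by_cases hx : x ∈ Set.univ.pi s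
    · rw [Set.indicator_of_mem hx]
      exact Finset.prod_congr rfl fun i _ => (Set.indicator_of_mem (hx i trivial) _).symm
    · rw [Set.indicator_of_notMem hx]
      simp only [Set.mem_pi, Set.mem_univ, true_implies, not_forall] at hx
      obtain ⟨i, hi⟩ := hx
      exact (Finset.prod_eq_zero (Finset.mem_univ i) (Set.indicator_of_notMem hi _)).symm
  rw [h, lintegral_pi_prod_eq_prod μ fun i => (hf i).indicator (hs i)]
  refine Finset.prod_congr rfl fun i _ => ?_
  rw [lintegral_indicator (hs i), withDensity_apply _ (hs i)]

/-- The Lebesgue density of the standard Gaussian vector. -/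
noncomputable def stdGaussPDF (n : ℕ) (y : Fin n → ℝ) : ℝ :=
  (√(2 * Real.pi))⁻¹ ^ n * Real.exp (-(∑ i, y i ^ 2) / 2)

theorem stdGaussVec_eq_withDensity (n : ℕ) :
    stdGaussVec n = volume.withDensity fun y => ENNReal.ofReal (stdGaussPDF n y) := by
  have h1 : (gaussianReal 0 1) = volume.withDensity (gaussianPDF 0 1) :=
    gaussianReal_of_var_ne_zero 0 one_ne_zero
  have : SigmaFinite ((volume : Measure ℝ).withDensity (gaussianPDF 0 1)) := by
    rw [← h1]; infer_instance
  rw [stdGaussVec, h1, pi_withDensity_eq _ fun _ => measurable_gaussianPDF 0 1, ← volume_pi]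
  congr 1
  ext y
  simp only [gaussianPDF]
  rw [← ENNReal.ofReal_prod_of_nonneg fun i _ => gaussianPDFReal_nonneg _ _ _]
  congr 1
  simp only [gaussianPDFReal, stdGaussPDF, Finset.prod_mul_distrib, Finset.prod_const,
    Finset.card_univ, Fintype.card_fin, ← Real.exp_sum, NNReal.coe_one, mul_one, sub_zero]
  rw [← Finset.sum_div, Finset.sum_neg_distrib]

/-- The density of `N(0, I + β x xᵀ)` with respect to `N(0, I)`, for a unit vector `x`. -/
noncomputable def spikeRatio {n : ℕ} (β : ℝ) (x y : Fin n → ℝ) : ℝ :=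
  (√(1 + β))⁻¹ * Real.exp (β / (2 * (1 + β)) * (∑ i, y i * x i) ^ 2)

/-- The linear map transforming `N(0, I)` into `N(0, I + β x xᵀ)`, for a unit vector `x`. -/
noncomputable def spikeMap {n : ℕ} (β : ℝ) (x y : Fin n → ℝ) : Fin n → ℝ :=
  y + ((√(1 + β) - 1) * ∑ i, y i * x i) • x

theorem measurable_spikeRatio {n : ℕ} (β : ℝ) :
    Measurable fun p : (Fin n → ℝ) × (Fin n → ℝ) => spikeRatio β p.1 p.2 := by
  unfold spikeRatio; fun_prop

theorem measurable_ofReal_spikeRatio {n : ℕ} (β : ℝ) (x : Fin n → ℝ) :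
    Measurable fun y => ENNReal.ofReal (spikeRatio β x y) :=
  ((measurable_spikeRatio β).comp measurable_prodMk_left).ennreal_ofReal

theorem measurable_spikeMap {n : ℕ} (β : ℝ) :
    Measurable fun p : (Fin n → ℝ) × (Fin n → ℝ) => spikeMap β p.1 p.2 := by
  unfold spikeMap; fun_prop

theorem sum_spikeMap_mul {n : ℕ} (β : ℝ) (x y z : Fin n → ℝ) :
    ∑ i, spikeMap β x y i * z i
      = ∑ i, y i * z i + (√(1 + β) - 1) * (∑ i, y i * x i) * ∑ i, x i * z i := by
  simp only [spikeMap, Pi.add_apply, Pi.smul_apply, smul_eq_mul, add_mul,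
    Finset.sum_add_distrib, Finset.mul_sum, mul_assoc]

theorem sum_spikeMap_sq {n : ℕ} {β : ℝ} (hβ : -1 < β) {x : Fin n → ℝ} (hx : ∑ i, x i ^ 2 = 1)
    (y : Fin n → ℝ) :
    ∑ i, spikeMap β x y i ^ 2 = ∑ i, y i ^ 2 + β * (∑ i, y i * x i) ^ 2 := by
  have hs : √(1 + β) ^ 2 = 1 + β := Real.sq_sqrt (by linarith)
  have hx' : ∑ i, x i * x i = 1 := by simpa only [sq] using hx
  have h1 : ∑ i, spikeMap β x y i ^ 2 = ∑ i, spikeMap β x y i * spikeMap β x y i := by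
    simp only [sq]
  have h2 (z : Fin n → ℝ) : ∑ i, z i * spikeMap β x y i = ∑ i, spikeMap β x y i * z i := by
    simp only [mul_comm]
  have h3 : ∑ i, x i * y i = ∑ i, y i * x i := by simp only [mul_comm]
  have h4 : ∑ i, y i * y i = ∑ i, y i ^ 2 := by simp only [sq]
  rw [h1, sum_spikeMap_mul, h2, h2, sum_spikeMap_mul, sum_spikeMap_mul, hx', h3, h4]
  linear_combination (∑ i, y i * x i) ^ 2 * hs

theorem stdGaussPDF_eq_spikeMap {n : ℕ} {β : ℝ} (hβ : -1 < β) {x : Fin n → ℝ}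
    (hx : ∑ i, x i ^ 2 = 1) (y : Fin n → ℝ) :
    stdGaussPDF n y = √(1 + β) *
      (stdGaussPDF n (spikeMap β x y) * spikeRatio β x (spikeMap β x y)) := by
  have hpos : 0 < 1 + β := by linarith
  have hs : √(1 + β) ^ 2 = 1 + β := Real.sq_sqrt hpos.le
  have hx' : ∑ i, x i * x i = 1 := by simpa only [sq] using hx
  have hne : √(1 + β) ≠ 0 := (Real.sqrt_pos.2 hpos).ne'
  simp only [stdGaussPDF, spikeRatio]
  rw [sum_spikeMap_sq hβ hx, sum_spikeMap_mul, hx']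
  set r := ∑ i, y i * x i
  set t := ∑ i, y i ^ 2
  have h : -t / 2 = -(t + β * r ^ 2) / 2
      + β / (2 * (1 + β)) * (r + (√(1 + β) - 1) * r * 1) ^ 2 := by
    have : (r + (√(1 + β) - 1) * r * 1) ^ 2 = (1 + β) * r ^ 2 := by
      linear_combination r ^ 2 * hs
    rw [this]; field_simp; ring
  rw [h, Real.exp_add]
  field_simp

theorem map_spikeMap_volume {n : ℕ} {β : ℝ} (hβ : -1 < β) {x : Fin n → ℝ}
    (hx : ∑ i, x i ^ 2 = 1) :
    (volume : Measure (Fin n → ℝ)).map (spikeMap β x)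
      = ENNReal.ofReal (√(1 + β))⁻¹ • volume := by
  have hpos : 0 < √(1 + β) := Real.sqrt_pos.2 (by linarith)
  let M : Matrix (Fin n) (Fin n) ℝ := 1 + Matrix.replicateCol Unit ((√(1 + β) - 1) • x) *
    Matrix.replicateRow Unit x
  have hdet : M.det = √(1 + β) := by
    have hx' : ∑ i, x i * x i = 1 := by simpa only [sq] using hx
    rw [Matrix.det_one_add_replicateCol_mul_replicateRow, dotProduct_smul, dotProduct, hx']
    simp
  have hM : spikeMap β x = Matrix.toLin' M := by
    ext y i
    rw [Matrix.toLin'_apply, Matrix.add_mulVec, Matrix.one_mulVec]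
    simp only [spikeMap, Pi.add_apply, Matrix.mulVec, dotProduct, Matrix.mul_apply, Matrix.replicateCol_apply,
      Matrix.replicateRow_apply, Pi.smul_apply, smul_eq_mul, Finset.univ_unique,
      Finset.sum_singleton, Finset.mul_sum, Finset.sum_mul]
    congr 1
    exact Finset.sum_congr rfl fun j _ => by ring
  rw [hM, Real.map_matrix_volume_pi_eq_smul_volume_pi (by rw [hdet]; exact hpos.ne'), hdet,
    abs_of_pos (inv_pos.2 hpos)]

theorem map_spikeMap_stdGaussVec {n : ℕ} {β : ℝ} (hβ : -1 < β) {x : Fin n → ℝ}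
    (hx : ∑ i, x i ^ 2 = 1) :
    (stdGaussVec n).map (spikeMap β x)
      = (stdGaussVec n).withDensity fun y => ENNReal.ofReal (spikeRatio β x y) := by
  have hpos : 0 < √(1 + β) := Real.sqrt_pos.2 (by linarith)
  have hT : Measurable (spikeMap β x) := (measurable_spikeMap β).comp measurable_prodMk_left
  have hp : Measurable fun y => ENNReal.ofReal (stdGaussPDF n y) := by
    unfold stdGaussPDF; fun_prop
  have hL := measurable_ofReal_spikeRatio β x
  ext s hs
  rw [Measure.map_apply hT hs, stdGaussVec_eq_withDensity, withDensity_apply _ (hT hs),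
    ← withDensity_mul _ hp hL, withDensity_apply _ hs, ← lintegral_indicator hs,
    ← lintegral_indicator (hT hs)]
  have h : ((spikeMap β x) ⁻¹' s).indicator (fun y => ENNReal.ofReal (stdGaussPDF n y))
      = fun y => ENNReal.ofReal √(1 + β) * s.indicator ((fun y => ENNReal.ofReal
        (stdGaussPDF n y)) * fun y => ENNReal.ofReal (spikeRatio β x y)) (spikeMap β x y) := by
    ext y
    by_cases hy : spikeMap β x y ∈ s
    · rw [Set.indicator_of_mem (by exact hy), Set.indicator_of_mem hy,
        stdGaussPDF_eq_spikeMap hβ hx, ENNReal.ofReal_mul hpos.le, ENNReal.ofReal_mul]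
      · rfl
      · unfold stdGaussPDF; positivity
    · rw [Set.indicator_of_notMem (by exact hy), Set.indicator_of_notMem hy, mul_zero]
  have hF : Measurable fun y => s.indicator ((fun y => ENNReal.ofReal (stdGaussPDF n y)) *
      fun y => ENNReal.ofReal (spikeRatio β x y)) (spikeMap β x y) :=
    ((hp.mul hL).indicator hs).comp hT
  simp only [h]
  rw [lintegral_const_mul _ hF,
    ← lintegral_map ((hp.mul hL).indicator hs) hT, map_spikeMap_volume hβ hx,
    lintegral_smul_measure, smul_eq_mul, ← mul_assoc, ← ENNReal.ofReal_mul hpos.le,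
    mul_inv_cancel₀ hpos.ne', ENNReal.ofReal_one, one_mul]

theorem lintegral_exp_sq_stdGaussVec {n : ℕ} {a : ℝ} {u : Fin n → ℝ} (hu : 0 < ∑ i, u i ^ 2)
    (ha : a * ∑ i, u i ^ 2 < 1) :
    ∫⁻ y, ENNReal.ofReal (Real.exp (a / 2 * (∑ i, y i * u i) ^ 2)) ∂(stdGaussVec n)
      = ENNReal.ofReal (√(1 - a * ∑ i, u i ^ 2))⁻¹ := by
  set t := ∑ i, u i ^ 2
  set β := a * t / (1 - a * t)
  have h1 : 0 < 1 - a * t := by linarith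
  have hβ1 : 1 + β = (1 - a * t)⁻¹ := by simp only [β]; field_simp; ring
  have hβ : -1 < β := by have := inv_pos.2 h1; linarith
  set x : Fin n → ℝ := fun i => u i / √t
  have hst : √t ^ 2 = t := Real.sq_sqrt hu.le
  have hx : ∑ i, x i ^ 2 = 1 := by
    simp only [x, div_pow, hst, ← Finset.sum_div]
    exact div_self hu.ne'
  have hmass := congrArg (fun μ => μ Set.univ) (map_spikeMap_stdGaussVec hβ hx)
  have hT : Measurable (spikeMap β x) := (measurable_spikeMap β).comp measurable_prodMk_left
  simp only [Measure.map_apply hT .univ, Set.preimage_univ, measure_univ,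
    withDensity_apply _ MeasurableSet.univ, Measure.restrict_univ] at hmass
  have hr (y : Fin n → ℝ) : Real.exp (a / 2 * (∑ i, y i * u i) ^ 2)
      = (√(1 - a * t))⁻¹ * spikeRatio β x y := by
    have hs : ∑ i, y i * x i = (∑ i, y i * u i) / √t := by
      simp only [x, ← mul_div_assoc, ← Finset.sum_div]
    have he : β / (2 * (1 + β)) * ((∑ i, y i * u i) / √t) ^ 2
        = a / 2 * (∑ i, y i * u i) ^ 2 := by
      rw [hβ1, div_pow, hst]; simp only [β]; field_simp
    rw [spikeRatio, hs, he, hβ1, Real.sqrt_inv, inv_inv, ← mul_assoc,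
      inv_mul_cancel₀ (Real.sqrt_pos.2 h1).ne', one_mul]
  simp only [hr, ENNReal.ofReal_mul (inv_nonneg.2 (Real.sqrt_nonneg (1 - a * t)))]
  rw [lintegral_const_mul _ (measurable_ofReal_spikeRatio β x), ← hmass, mul_one]

theorem lintegral_spikeRatio_mul {n : ℕ} {β : ℝ} (hβ : β ∈ Set.Ioo (-1 : ℝ) 1)
    {x x' : Fin n → ℝ} (hx : ∑ i, x i ^ 2 = 1) (hx' : ∑ i, x' i ^ 2 = 1) :
    0 < 1 - β ^ 2 * (∑ i, x i * x' i) ^ 2 ∧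
    ∫⁻ y, ENNReal.ofReal (spikeRatio β x y) * ENNReal.ofReal (spikeRatio β x' y)
        ∂(stdGaussVec n)
      = ENNReal.ofReal (√(1 - β ^ 2 * (∑ i, x i * x' i) ^ 2))⁻¹ := by
  have hpos : 0 < 1 + β := by linarith [hβ.1]
  have hL := measurable_ofReal_spikeRatio β x
  have hL' := measurable_ofReal_spikeRatio β x'
  have hT : Measurable (spikeMap β x) := (measurable_spikeMap β).comp measurable_prodMk_left
  have hu := sum_spikeMap_sq hβ.1 hx x'
  have hcomm : ∑ i, x' i * x i = ∑ i, x i * x' i := by simp only [mul_comm]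
  rw [hx', hcomm] at hu
  have hcs : (∑ i, x i * x' i) ^ 2 ≤ 1 := by
    simpa only [hx, hx', mul_one] using Finset.sum_mul_sq_le_sq_mul_sq Finset.univ x x'
  set ρ := ∑ i, x i * x' i
  have hβ2 : β ^ 2 < 1 := by nlinarith [hβ.1, hβ.2]
  have h1 : 0 < 1 - β ^ 2 * ρ ^ 2 := by nlinarith [sq_nonneg β, sq_nonneg ρ]
  have hu0 : 0 < 1 + β * ρ ^ 2 := by
    nlinarith [mul_nonneg hpos.le (sq_nonneg ρ), sq_nonneg (β * ρ),
      mul_nonneg hpos.le (sub_nonneg.2 hcs), hβ.1]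
  have hadj (y : Fin n → ℝ) : ∑ i, spikeMap β x y i * x' i = ∑ i, y i * spikeMap β x x' i := by
    have : ∑ i, y i * spikeMap β x x' i = ∑ i, spikeMap β x x' i * y i := by
      simp only [mul_comm]
    rw [this, sum_spikeMap_mul, sum_spikeMap_mul, hcomm]
    have h2 : ∑ i, x' i * y i = ∑ i, y i * x' i := by simp only [mul_comm]
    have h3 : ∑ i, x i * y i = ∑ i, y i * x i := by simp only [mul_comm]
    rw [h2, h3]; ring
  have h2 : 1 - β / (1 + β) * (1 + β * ρ ^ 2) = (1 - β ^ 2 * ρ ^ 2) / (1 + β) := by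
    field_simp; ring
  have h3 : β / (1 + β) * ∑ i, spikeMap β x x' i ^ 2 < 1 := by
    rw [hu]; have := div_pos h1 hpos; linarith
  have hmain := lintegral_exp_sq_stdGaussVec (by rw [hu]; exact hu0) h3
  refine ⟨h1, ?_⟩
  have hwd := lintegral_withDensity_eq_lintegral_mul (stdGaussVec n) hL hL'
  simp only [Pi.mul_apply] at hwd
  rw [← hwd, ← map_spikeMap_stdGaussVec hβ.1 hx, lintegral_map hL' hT]
  have h4 (y : Fin n → ℝ) : spikeRatio β x' (spikeMap β x y) = (√(1 + β))⁻¹ *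
      Real.exp (β / (1 + β) / 2 * (∑ i, y i * spikeMap β x x' i) ^ 2) := by
    rw [spikeRatio, hadj, div_div, mul_comm (1 + β) 2]
  simp only [h4, ENNReal.ofReal_mul (inv_nonneg.2 (Real.sqrt_nonneg (1 + β)))]
  rw [lintegral_const_mul _ (by fun_prop), hmain, hu, h2,
    ← ENNReal.ofReal_mul (inv_nonneg.2 (Real.sqrt_nonneg (1 + β))), Real.sqrt_div h1.le]
  have := (Real.sqrt_pos.2 hpos).ne'
  congr 1
  field_simp

instance (n N : ℕ) : IsProbabilityMeasure (wishartUnspiked n N) := by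
  unfold wishartUnspiked; infer_instance

theorem map_spikeMap_wishartUnspiked {n : ℕ} (N : ℕ) {β : ℝ} (hβ : -1 < β) {x : Fin n → ℝ}
    (hx : ∑ i, x i ^ 2 = 1) :
    (wishartUnspiked n N).map (fun G j => spikeMap β x (G j))
      = (wishartUnspiked n N).withDensity fun G =>
        ∏ j, ENNReal.ofReal (spikeRatio β x (G j)) := by
  have hT : Measurable (spikeMap β x) := (measurable_spikeMap β).comp measurable_prodMk_left
  have h := map_spikeMap_stdGaussVec hβ hx
  have hprob : IsProbabilityMeasure ((stdGaussVec n).map (spikeMap β x)) :=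
    Measure.isProbabilityMeasure_map hT.aemeasurable
  have : IsProbabilityMeasure
      ((stdGaussVec n).withDensity fun y => ENNReal.ofReal (spikeRatio β x y)) := h ▸ hprob
  rw [wishartUnspiked, Measure.pi_map_pi (fun _ => hT.aemeasurable), h,
    pi_withDensity_eq _ fun _ => measurable_ofReal_spikeRatio β x]

theorem measurable_map_spikeMap_wishartUnspiked (n N : ℕ) (β : ℝ) :
    Measurable fun x => (wishartUnspiked n N).map (fun G j => spikeMap β x (G j)) := by
  have hF : Measurable fun p : (Fin n → ℝ) × (Fin N → Fin n → ℝ) =>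
      fun j => spikeMap β p.1 (p.2 j) :=
    measurable_pi_lambda _ fun j => (measurable_spikeMap β).comp
      (measurable_fst.prodMk ((measurable_pi_apply j).comp measurable_snd))
  convert (Measure.measurable_map _ hF).comp
    (Measurable.map_prodMk_left (ν := wishartUnspiked n N)) using 2 with x
  exact (Measure.map_map hF measurable_prodMk_left).symm

theorem measurable_prod_spikeRatio (n N : ℕ) (β : ℝ) :
    Measurable (Function.uncurry fun (G : Fin N → Fin n → ℝ) (x : Fin n → ℝ) =>
      ∏ j, ENNReal.ofReal (spikeRatio β x (G j))) :=
  Finset.measurable_prod _ fun j _ => ((measurable_spikeRatio β).comp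
    (measurable_snd.prodMk ((measurable_pi_apply j).comp measurable_fst))).ennreal_ofReal

theorem wishartSpiked_eq_withDensity {n : ℕ} (N : ℕ) {β : ℝ} (hβ : -1 < β)
    (prior : Measure (Fin n → ℝ)) [IsProbabilityMeasure prior]
    (hsupp : ∀ᵐ x ∂prior, ∑ i, (x i) ^ 2 = 1) :
    wishartSpiked n N β prior = (wishartUnspiked n N).withDensity fun G =>
      ∫⁻ x, ∏ j, ENNReal.ofReal (spikeRatio β x (G j)) ∂prior := by
  ext s hs
  have hm := measurable_map_spikeMap_wishartUnspiked n N β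
  rw [wishartSpiked]
  refine (Measure.bind_apply hs hm.aemeasurable).trans ?_
  rw [withDensity_apply _ hs,
    lintegral_lintegral_swap (measurable_prod_spikeRatio n N β).aemeasurable]
  refine lintegral_congr_ae ?_
  filter_upwards [hsupp] with x hx
  rw [map_spikeMap_wishartUnspiked N hβ hx, withDensity_apply _ hs]

/-- Second moment of the spiked Wishart likelihood ratio: for `β ∈ (-1,1)` and a
spike prior supported on the unit sphere, `P ≪ Q` and
`∫ (dP/dQ)² dQ = E_{x,x' ~ 𝒳} (1 - β² ⟨x,x'⟩²)^{-N/2}`. -/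
theorem stmt_11 (n N : ℕ) (hn : 1 ≤ n) (hN : 1 ≤ N)
    (β : ℝ) (hβ : β ∈ Set.Ioo (-1 : ℝ) 1)
    (prior : Measure (Fin n → ℝ)) [IsProbabilityMeasure prior]
    (hsupp : ∀ᵐ x ∂prior, ∑ i, (x i) ^ 2 = 1) :
    wishartSpiked n N β prior ≪ wishartUnspiked n N ∧
      ∫⁻ X, ((wishartSpiked n N β prior).rnDeriv (wishartUnspiked n N) X) ^ 2
          ∂(wishartUnspiked n N)
        = ∫⁻ x, ∫⁻ x',
            ENNReal.ofReal ((1 - β ^ 2 * (∑ i, x i * x' i) ^ 2) ^ (-(N : ℝ) / 2))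
            ∂prior ∂prior := by
  have hmeas := measurable_prod_spikeRatio n N β
  have hx_meas (G : Fin N → Fin n → ℝ) :
      Measurable fun x => ∏ j, ENNReal.ofReal (spikeRatio β x (G j)) :=
    hmeas.of_uncurry_left
  have hG_meas (x : Fin n → ℝ) :
      Measurable fun G : Fin N → Fin n → ℝ => ∏ j, ENNReal.ofReal (spikeRatio β x (G j)) :=
    hmeas.of_uncurry_right
  have hℓ : Measurable fun G : Fin N → Fin n → ℝ =>
      ∫⁻ x, ∏ j, ENNReal.ofReal (spikeRatio β x (G j)) ∂prior := hmeas.lintegral_prod_right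
  rw [wishartSpiked_eq_withDensity N hβ.1 prior hsupp]
  refine ⟨withDensity_absolutelyContinuous _ _, ?_⟩
  calc
    _ = ∫⁻ G, (∫⁻ x, ∏ j, ENNReal.ofReal (spikeRatio β x (G j)) ∂prior) ^ 2
          ∂(wishartUnspiked n N) := by
      refine lintegral_congr_ae ?_
      filter_upwards [Measure.rnDeriv_withDensity (wishartUnspiked n N) hℓ] with G hG
      rw [hG]
    _ = ∫⁻ G, ∫⁻ x, (∏ j, ENNReal.ofReal (spikeRatio β x (G j))) *
          ∫⁻ x', ∏ j, ENNReal.ofReal (spikeRatio β x' (G j)) ∂prior ∂prior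
          ∂(wishartUnspiked n N) := by
      refine lintegral_congr fun G => ?_
      rw [lintegral_mul_const _ (hx_meas G), sq]
    _ = ∫⁻ x, ∫⁻ G, (∏ j, ENNReal.ofReal (spikeRatio β x (G j))) *
          ∫⁻ x', ∏ j, ENNReal.ofReal (spikeRatio β x' (G j)) ∂prior
          ∂(wishartUnspiked n N) ∂prior := by
      have h : Measurable (Function.uncurry fun (G : Fin N → Fin n → ℝ) (x : Fin n → ℝ) =>
          (∏ j, ENNReal.ofReal (spikeRatio β x (G j))) *
            ∫⁻ x', ∏ j, ENNReal.ofReal (spikeRatio β x' (G j)) ∂prior) :=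
        hmeas.mul (hℓ.comp measurable_fst)
      exact lintegral_lintegral_swap h.aemeasurable
    _ = ∫⁻ x, ∫⁻ x', ∫⁻ G, (∏ j, ENNReal.ofReal (spikeRatio β x (G j))) *
          (∏ j, ENNReal.ofReal (spikeRatio β x' (G j)))
          ∂(wishartUnspiked n N) ∂prior ∂prior := by
      refine lintegral_congr fun x => ?_
      have h : Measurable (Function.uncurry fun (G : Fin N → Fin n → ℝ) (x' : Fin n → ℝ) =>
          (∏ j, ENNReal.ofReal (spikeRatio β x (G j))) *
            ∏ j, ENNReal.ofReal (spikeRatio β x' (G j))) :=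
        ((hG_meas x).comp measurable_fst).mul hmeas
      rw [← lintegral_lintegral_swap h.aemeasurable]
      exact lintegral_congr fun G => (lintegral_const_mul _ (hx_meas G)).symm
    _ = _ := by
      refine lintegral_congr_ae ?_
      filter_upwards [hsupp] with x hx
      refine lintegral_congr_ae ?_
      filter_upwards [hsupp] with x' hx'
      obtain ⟨hpos, hint⟩ := lintegral_spikeRatio_mul hβ hx hx'
      have hm : Measurable fun y =>
          ENNReal.ofReal (spikeRatio β x y) * ENNReal.ofReal (spikeRatio β x' y) :=
        (measurable_ofReal_spikeRatio β x).mul (measurable_ofReal_spikeRatio β x')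
      simp only [← Finset.prod_mul_distrib]
      rw [wishartUnspiked, lintegral_pi_prod_eq_prod _ fun _ => hm, hint,
        Finset.prod_const, Finset.card_univ, Fintype.card_fin,
        ← ENNReal.ofReal_pow (inv_nonneg.2 (Real.sqrt_nonneg _)), Real.sqrt_eq_rpow,
        ← Real.rpow_neg hpos.le, ← Real.rpow_mul_natCast hpos.le]
      congr 2
      ring
end

section
/- Let 0 < γ ≤ 1/3 and 0 < b < γ. Then for every t ∈ (0, 1), (1/2)(1+√t)·log(1+√t) + (1/2)(1−√t)·log(1−√t) > −(1/(2γ))·log(1 − b·t). (With b = β², this says that the large-deviations rate function f(t) = log 2 − H((1+√t)/2) of the i.i.d. Rademacher prior strictly dominates −log(1−β²t)/(2γ) on (0,1) whenever γ ≤ 1/3 and β² < γ; consequently the Rademacher-spiked Wishart model is contiguous to the unspiked model below the spectral threshold.) -/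
open Real

/-- Power series in `t` of the Rademacher rate function. -/
lemma hasSum_rademacher_rate {t : ℝ} (ht0 : 0 ≤ t) (ht1 : t < 1) :
    HasSum (fun n : ℕ => t ^ (n + 1) / (2 * (n + 1) * (2 * n + 1)))
      ((1 / 2) * (1 + √t) * log (1 + √t) + (1 / 2) * (1 - √t) * log (1 - √t)) := by
  have hs0 : 0 ≤ √t := sqrt_nonneg t
  have hs1 : √t < 1 := (sqrt_lt' one_pos).2 (by simpa using ht1)
  have hsq : √t ^ 2 = t := sq_sqrt ht0
  have h1 := (hasSum_log_sub_log_of_abs_lt_one (x := √t)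
    (by rwa [abs_of_nonneg hs0])).mul_left (√t / 2)
  have h2 := (hasSum_pow_div_log_of_abs_lt_one (x := t)
    (by rwa [abs_of_nonneg ht0])).mul_left (1 / 2)
  have hlog : log (1 - t) = log (1 + √t) + log (1 - √t) := by
    rw [← log_mul (by positivity) (by linarith)]
    congr 1
    linear_combination hsq
  convert h1.sub h2 using 1
  · rfl
  · funext n
    have hpow : √t * √t ^ (2 * n + 1) = t ^ (n + 1) := by
      rw [← pow_succ', show 2 * n + 1 + 1 = 2 * (n + 1) by ring, pow_mul, hsq]
    rw [show √t / 2 * (2 * (1 / (2 * (n : ℝ) + 1)) * √t ^ (2 * n + 1)) =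
      (√t * √t ^ (2 * n + 1)) / (2 * n + 1) by ring, hpow]
    field_simp
    ring
  · rw [hlog]
    ring

lemma pow_mul_two_mul_add_one_le_one {x : ℝ} (hx0 : 0 ≤ x) (hx : x ≤ 1 / 3) (n : ℕ) :
    x ^ n * (2 * n + 1) ≤ 1 := by
  have hbern : 1 + (n : ℝ) * 2 ≤ (1 + 2) ^ n := one_add_mul_le_pow (by norm_num) n
  calc x ^ n * (2 * n + 1) ≤ (1 / 3) ^ n * (1 + 2) ^ n := by
        gcongr
        linarith
    _ = 1 := by rw [← mul_pow]; norm_num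

/-- For `0 < γ ≤ 1/3`, `0 < b < γ`, and `t ∈ (0,1)`, the Rademacher rate function
strictly dominates `-log(1 - b t)/(2γ)`:
`½(1+√t)log(1+√t) + ½(1-√t)log(1-√t) > -(1/(2γ)) log(1 - b t)`. -/
theorem stmt_14 (γ b : ℝ) (hγ0 : 0 < γ) (hγ : γ ≤ 1 / 3) (hb0 : 0 < b) (hb : b < γ)
    (t : ℝ) (ht : t ∈ Set.Ioo (0 : ℝ) 1) :
    -(1 / (2 * γ)) * Real.log (1 - b * t) <
      (1 / 2) * (1 + Real.sqrt t) * Real.log (1 + Real.sqrt t) +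
        (1 / 2) * (1 - Real.sqrt t) * Real.log (1 - Real.sqrt t) := by
  obtain ⟨ht0, ht1⟩ := ht
  have hbt : |b * t| < 1 := by
    rw [abs_of_pos (by positivity)]
    nlinarith
  have hlog := (hasSum_pow_div_log_of_abs_lt_one hbt).mul_left (1 / (2 * γ))
  rw [mul_neg, ← neg_mul] at hlog
  have hterm (n : ℕ) : 1 / (2 * γ) * ((b * t) ^ (n + 1) / (n + 1)) <
      t ^ (n + 1) / (2 * (n + 1) * (2 * n + 1)) := by
    have hpow : b ^ (n + 1) * (2 * n + 1) < γ := calc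
      b ^ (n + 1) * (2 * n + 1) < γ ^ (n + 1) * (2 * n + 1) := by gcongr
      _ = γ * (γ ^ n * (2 * n + 1)) := by ring
      _ ≤ γ := mul_le_of_le_one_right hγ0.le (pow_mul_two_mul_add_one_le_one hγ0.le hγ n)
    rw [mul_pow, div_mul_div_comm, div_lt_div_iff₀ (by positivity) (by positivity)]
    have := mul_lt_mul_of_pos_left hpow (show 0 < 2 * ((n : ℝ) + 1) * t ^ (n + 1) by positivity)
    linarith
  exact hasSum_lt (fun n => (hterm n).le) (hterm 0) hlog
    (hasSum_rademacher_rate ht0.le ht1)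
end

section
/- Let z ∈ (0, 1). For p a positive integer, let χ²_p denote the chi-square distribution with p degrees of freedom, i.e. the Gamma distribution with shape p/2 and rate 1/2. Then (1/p)·log P[χ²_p < z·p] → (1/2)(1 − z + log z) as p → ∞. -/
open MeasureTheory Filter Topology ProbabilityTheory

lemma Real.rpow_le_exp_mul_sub_one {y a : ℝ} (hy : 0 < y) (ha : 0 ≤ a) :
    y ^ a ≤ Real.exp (a * (y - 1)) := by
  rw [Real.rpow_def_of_pos hy, mul_comm]
  gcongr
  exact Real.log_le_sub_one_of_pos hy

lemma Real.Gamma_add_one_le_rpow_mul_exp {a : ℝ} (ha : 0 < a) :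
    Real.Gamma (a + 1) ≤ (a + 1) ^ (a + 1) * Real.exp (-a) := by
  have hb : 0 < a + 1 := by linarith
  have hint : IntegrableOn (fun x : ℝ => Real.exp (-(1 / (a + 1)) * x)) (Set.Ioi 0) :=
    integrableOn_exp_mul_Ioi (by simp only [Left.neg_neg_iff]; positivity) 0
  have hval : ∫ x in Set.Ioi (0 : ℝ), Real.exp (-(1 / (a + 1)) * x) = a + 1 := by
    rw [integral_exp_mul_Ioi (by simp only [Left.neg_neg_iff]; positivity) 0]
    simp
  calc Real.Gamma (a + 1)
      = ∫ x in Set.Ioi (0 : ℝ), Real.exp (-x) * x ^ (a + 1 - 1) := Real.Gamma_eq_integral hb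
    _ ≤ ∫ x in Set.Ioi (0 : ℝ),
          (a + 1) ^ a * Real.exp (-a) * Real.exp (-(1 / (a + 1)) * x) := by
        refine setIntegral_mono_on (Real.GammaIntegral_convergent hb) (hint.const_mul _)
          measurableSet_Ioi fun x (hx : 0 < x) => ?_
        have hy := Real.rpow_le_exp_mul_sub_one (div_pos hx hb) ha.le
        rw [Real.div_rpow hx.le hb.le, div_le_iff₀ (by positivity)] at hy
        calc Real.exp (-x) * x ^ (a + 1 - 1)
            ≤ Real.exp (-x) * (Real.exp (a * (x / (a + 1) - 1)) * (a + 1) ^ a) := by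
              rw [add_sub_cancel_right]; gcongr
          _ = (a + 1) ^ a * (Real.exp (-x) * Real.exp (a * (x / (a + 1) - 1))) := by ring
          _ = (a + 1) ^ a * (Real.exp (-a) * Real.exp (-(1 / (a + 1)) * x)) := by
              rw [← Real.exp_add, ← Real.exp_add]
              congr 2
              field_simp
              ring
          _ = _ := by ring
    _ = (a + 1) ^ (a + 1) * Real.exp (-a) := by
        rw [integral_const_mul, hval, Real.rpow_add_one hb.ne']
        ring

lemma ProbabilityTheory.gammaMeasure_Iio_le {a r s u : ℝ} (ha : 0 < a) (hr : 0 < r)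
    (hrs : r ≤ s) :
    gammaMeasure a r (Set.Iio u) ≤ ENNReal.ofReal ((r / s) ^ a * Real.exp ((s - r) * u)) := by
  have hs : 0 < s := hr.trans_le hrs
  rw [gammaMeasure, withDensity_apply _ measurableSet_Iio]
  calc ∫⁻ w in Set.Iio u, gammaPDF a r w
      ≤ ∫⁻ w in Set.Iio u,
          ENNReal.ofReal ((r / s) ^ a * Real.exp ((s - r) * u)) * gammaPDF a s w := by
        refine setLIntegral_mono' measurableSet_Iio fun w (hw : w < u) => ?_
        rcases lt_or_ge w 0 with h0 | h0
        · simp [gammaPDF_of_neg h0]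
        rw [gammaPDF_of_nonneg h0, gammaPDF_of_nonneg h0, ← ENNReal.ofReal_mul (by positivity)]
        apply ENNReal.ofReal_le_ofReal
        have hΓ := Real.Gamma_pos_of_pos ha
        have hexp : Real.exp (-(r * w)) ≤ Real.exp ((s - r) * u) * Real.exp (-(s * w)) := by
          rw [← Real.exp_add, Real.exp_le_exp]
          nlinarith [mul_le_mul_of_nonneg_left hw.le (sub_nonneg.2 hrs)]
        calc r ^ a / Real.Gamma a * w ^ (a - 1) * Real.exp (-(r * w))
            ≤ r ^ a / Real.Gamma a * w ^ (a - 1) *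
                (Real.exp ((s - r) * u) * Real.exp (-(s * w))) := by gcongr
          _ = _ := by
            rw [Real.div_rpow hr.le hs.le]
            have := (Real.rpow_pos_of_pos hs a).ne'
            field_simp
    _ ≤ ENNReal.ofReal ((r / s) ^ a * Real.exp ((s - r) * u)) * ∫⁻ w, gammaPDF a s w := by
        rw [lintegral_const_mul' _ _ ENNReal.ofReal_ne_top]
        gcongr
        exact Measure.restrict_le_self
    _ = _ := by rw [lintegral_gammaPDF_eq_one ha hs, mul_one]

lemma ProbabilityTheory.le_gammaMeasure_Iio {a r u : ℝ} (ha : 0 < a) (hr : 0 < r)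
    (hu : 0 ≤ u) :
    ENNReal.ofReal ((r * u) ^ a * Real.exp (-(r * u)) / Real.Gamma (a + 1)) ≤
      gammaMeasure a r (Set.Iio u) := by
  have hΓ := Real.Gamma_pos_of_pos ha
  have hint : IntervalIntegrable (fun w : ℝ => w ^ (a - 1)) volume 0 u :=
    intervalIntegral.intervalIntegrable_rpow' (by linarith)
  have hpow : ∫ w in Set.Ioo 0 u, w ^ (a - 1) = u ^ a / a := by
    rw [← integral_Ioc_eq_integral_Ioo, ← intervalIntegral.integral_of_le hu,
      integral_rpow (Or.inl (by linarith))]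
    simp [ha.ne']
  rw [gammaMeasure, withDensity_apply _ measurableSet_Iio]
  calc ENNReal.ofReal ((r * u) ^ a * Real.exp (-(r * u)) / Real.Gamma (a + 1))
      = ENNReal.ofReal (∫ w in Set.Ioo 0 u,
          r ^ a / Real.Gamma a * Real.exp (-(r * u)) * w ^ (a - 1)) := by
        rw [integral_const_mul, hpow, Real.Gamma_add_one ha.ne', Real.mul_rpow hr.le hu]
        congr 1
        field_simp
    _ = ∫⁻ w in Set.Ioo 0 u,
          ENNReal.ofReal (r ^ a / Real.Gamma a * Real.exp (-(r * u)) * w ^ (a - 1)) := by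
        refine ofReal_integral_eq_lintegral_ofReal ?_ ?_
        · exact (((intervalIntegrable_iff_integrableOn_Ioo_of_le hu).1 hint).const_mul _)
        · refine (ae_restrict_iff' measurableSet_Ioo).2 (ae_of_all _ fun w hw => ?_)
          have := hw.1
          simp only [Pi.zero_apply]
          positivity
    _ ≤ ∫⁻ w in Set.Ioo 0 u, gammaPDF a r w := by
        refine setLIntegral_mono' measurableSet_Ioo fun w hw => ?_
        have h0 : 0 < w := hw.1
        have h1 : w ≤ u := hw.2.le
        rw [gammaPDF_of_nonneg h0.le, mul_right_comm]
        gcongr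
    _ ≤ ∫⁻ w in Set.Iio u, gammaPDF a r w :=
        lintegral_mono_set Set.Ioo_subset_Iio_self

lemma log_chiSquare_Iio_le {z p : ℝ} (hz : z ∈ Set.Ioo (0 : ℝ) 1) (hp : 0 < p)
    (hpos : 0 < (gammaMeasure (p / 2) (1 / 2) (Set.Iio (z * p))).toReal) :
    Real.log (gammaMeasure (p / 2) (1 / 2) (Set.Iio (z * p))).toReal ≤
      p * ((1 - z + Real.log z) / 2) := by
  obtain ⟨hz0, hz1⟩ := hz
  have h := gammaMeasure_Iio_le (a := p / 2) (r := 1 / 2) (s := 1 / (2 * z)) (u := z * p)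
    (by positivity) (by norm_num) (by gcongr; linarith)
  have hlog := Real.log_le_log hpos (ENNReal.toReal_le_of_le_ofReal (by positivity) h)
  refine hlog.trans_eq ?_
  rw [show (1 / 2 : ℝ) / (1 / (2 * z)) = z by field_simp, Real.log_mul (by positivity)
    (Real.exp_ne_zero _), Real.log_rpow hz0, Real.log_exp]
  field_simp
  ring

lemma le_log_chiSquare_Iio {z p : ℝ} (hz : 0 < z) (hp : 2 ≤ p)
    (htop : gammaMeasure (p / 2) (1 / 2) (Set.Iio (z * p)) ≠ ⊤) :
    0 < (gammaMeasure (p / 2) (1 / 2) (Set.Iio (z * p))).toReal ∧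
      p * ((1 - z + Real.log z) / 2) - (1 + Real.log p) ≤
        Real.log (gammaMeasure (p / 2) (1 / 2) (Set.Iio (z * p))).toReal := by
  obtain ⟨a, rfl⟩ : ∃ a, p = 2 * a := ⟨p / 2, by ring⟩
  have ha : 1 ≤ a := by linarith
  have ha0 : 0 < a := by linarith
  have hΓ : 0 < Real.Gamma (a + 1) := Real.Gamma_pos_of_pos (by linarith)
  have h := le_gammaMeasure_Iio (a := a) (r := 1 / 2) (u := z * (2 * a)) ha0 (by norm_num)
    (by positivity)
  rw [show 1 / 2 * (z * (2 * a)) = z * a by ring] at h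
  rw [show 2 * a / 2 = a by ring] at htop ⊢
  have h' := (ENNReal.ofReal_le_iff_le_toReal htop).1 h
  have hlow : 0 < (z * a) ^ a * Real.exp (-(z * a)) / Real.Gamma (a + 1) := by positivity
  refine ⟨hlow.trans_le h', le_trans ?_ (Real.log_le_log hlow h')⟩
  have hlogΓ := Real.log_le_log hΓ (Real.Gamma_add_one_le_rpow_mul_exp ha0)
  rw [Real.log_mul (by positivity) (Real.exp_ne_zero _), Real.log_rpow (by linarith),
    Real.log_exp] at hlogΓ
  rw [Real.log_div (by positivity) hΓ.ne', Real.log_mul (by positivity) (Real.exp_ne_zero _),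
    Real.log_rpow (by positivity), Real.log_exp, Real.log_mul hz.ne' ha0.ne']
  have h1 : a * (Real.log (a + 1) - Real.log a) ≤ 1 := by
    rw [← Real.log_div (by positivity) ha0.ne']
    calc a * Real.log ((a + 1) / a) ≤ a * ((a + 1) / a - 1) := by
          gcongr; exact Real.log_le_sub_one_of_pos (by positivity)
      _ = 1 := by field_simp; ring
  have h2 : Real.log (a + 1) ≤ Real.log (2 * a) := Real.log_le_log (by linarith) (by linarith)
  linarith

/-- Lower-tail large deviations for the chi-square distribution: for `z ∈ (0,1)`,
`(1/p) log P[χ²_p < z p] → (1 - z + log z)/2` as `p → ∞`, where `χ²_p` is the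
Gamma distribution with shape `p/2` and rate `1/2`. -/
theorem stmt_15 (z : ℝ) (hz : z ∈ Set.Ioo (0 : ℝ) 1) :
    Tendsto (fun p : ℕ => (1 / (p : ℝ)) *
        Real.log ((gammaMeasure ((p : ℝ) / 2) (1 / 2) {w | w < z * p}).toReal))
      atTop (𝓝 ((1 - z + Real.log z) / 2)) := by
  have herr : Tendsto (fun p : ℕ => (1 + Real.log p) / (p : ℝ)) atTop (𝓝 0) := by
    have hinv : Tendsto (fun x : ℝ => 1 / x) atTop (𝓝 0) :=
      tendsto_const_nhds.div_atTop tendsto_id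
    have hlog := Real.isLittleO_log_id_atTop.tendsto_div_nhds_zero
    have := (hinv.add hlog).comp tendsto_natCast_atTop_atTop
    simpa [Function.comp_def, add_div] using this
  have hlower : Tendsto (fun p : ℕ => (1 - z + Real.log z) / 2 - (1 + Real.log p) / (p : ℝ))
      atTop (𝓝 ((1 - z + Real.log z) / 2)) := by
    simpa using tendsto_const_nhds.sub herr
  refine tendsto_of_tendsto_of_tendsto_of_le_of_le' hlower tendsto_const_nhds ?_ ?_
  all_goals
    filter_upwards [eventually_ge_atTop 2] with p hp
    have hp2 : (2 : ℝ) ≤ p := by exact_mod_cast hp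
    have hp0 : (0 : ℝ) < p := by linarith
    have : IsProbabilityMeasure (gammaMeasure ((p : ℝ) / 2) (1 / 2)) :=
      isProbabilityMeasure_gammaMeasure (by positivity) (by norm_num)
    obtain ⟨hpos, hle⟩ := le_log_chiSquare_Iio hz.1 hp2 (measure_ne_top _ _)
    rw [one_div_mul_eq_div]
  · rw [le_div_iff₀ hp0]
    refine le_of_eq_of_le ?_ hle
    field_simp
  · rw [div_le_iff₀' hp0]
    exact log_chiSquare_Iio_le hz hp0 hpos
end
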